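/- arXiv:2509.13153 — 4 statements merged into one kernel-verified Lean document; each statement's English description precedes it below -/
import Mathlib

section
/- If F is a quadratic number field with discriminant D_F having t distinct prime divisors, then the 2-rank of the class group of F equals t-2 if F is real and some prime p ≡ 3 (mod 4) divides D_F, and equals t-1 otherwise. -/
open NumberField Subgroup
open scoped nonZeroDivisors
open IsDedekindDomain (HeightOneSpectrum)

theorem card_sq_eq_one_of_exact {G I C : Type*} [CommGroup G] [CommGroup I] [CommGroup C]
    (P : G →* I) (q : I →* C) (hq : Function.Surjective q) (hker : q.ker = P.range)
    (hinj : Function.Injective (powMonoidHom 2 : I →* I)) :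
    Nat.card {x : C // x ^ 2 = 1} =
      (P.ker ⊔ (powMonoidHom 2 : G →* G).range).relIndex
        ((powMonoidHom 2 : I →* I).range.comap P) := by
  have hK : Nat.card {x : C // x ^ 2 = 1} =
      P.range.relIndex (P.range.comap (powMonoidHom 2 : I →* I)) := by
    rw [← hker, relIndex_ker]
    refine Nat.card_congr (Equiv.subtypeEquivRight fun x ↦ ?_)
    obtain ⟨i, rfl⟩ := hq x
    rw [← map_pow, ← MonoidHom.mem_ker, Subgroup.mem_map]
    constructor
    · exact fun h ↦ ⟨i, h, rfl⟩
    · rintro ⟨j, hj, hji⟩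
      rw [mem_comap, powMonoidHom_apply, MonoidHom.mem_ker, map_pow] at hj
      rw [MonoidHom.mem_ker, map_pow, ← hji, hj]
  have h1 : (P.range.comap (powMonoidHom 2 : I →* I)).map (powMonoidHom 2) =
      ((powMonoidHom 2 : I →* I).range.comap P).map P := by
    rw [map_comap_eq, map_comap_eq, inf_comm]
  have h2 : P.range.map (powMonoidHom 2 : I →* I) =
      (powMonoidHom 2 : G →* G).range.map P := by
    rw [MonoidHom.range_eq_map, MonoidHom.range_eq_map, map_map, map_map]
    congr 1
    ext; simp
  rw [hK, ← relIndex_map_map_of_injective _ _ hinj, h1, h2, ← relIndex_comap, comap_map_eq,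
    sup_comm]

theorem index_sq_eq_relIndex_mul {G : Type*} [CommGroup G] (T : Subgroup G)
    (hT : ∀ x : G, x ^ 2 ∈ T → x ∈ T) :
    (powMonoidHom 2 : G →* G).range.index =
      (powMonoidHom 2 : T →* T).range.index * (powMonoidHom 2 : G ⧸ T →* G ⧸ T).range.index := by
  have h1 : (powMonoidHom 2 : G →* G).range.relIndex T = (powMonoidHom 2 : T →* T).range.index := by
    rw [relIndex]
    congr 1
    ext ⟨x, hx⟩
    simp only [mem_subgroupOf, MonoidHom.mem_range, powMonoidHom_apply]
    constructor
    · rintro ⟨y, rfl⟩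
      exact ⟨⟨y, hT y hx⟩, rfl⟩
    · rintro ⟨y, hy⟩
      exact ⟨y, congrArg Subtype.val hy⟩
  have h2 : ((powMonoidHom 2 : G →* G).range ⊔ T).index =
      (powMonoidHom 2 : G ⧸ T →* G ⧸ T).range.index := by
    rw [← index_comap_of_surjective _ (QuotientGroup.mk'_surjective T)]
    congr 1
    have : (powMonoidHom 2 : G ⧸ T →* G ⧸ T).range =
        (powMonoidHom 2 : G →* G).range.map (QuotientGroup.mk' T) := by
      ext x
      constructor
      · rintro ⟨y, rfl⟩
        obtain ⟨y, rfl⟩ := QuotientGroup.mk'_surjective T y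
        exact ⟨y ^ 2, ⟨y, rfl⟩, rfl⟩
      · rintro ⟨_, ⟨y, rfl⟩, rfl⟩
        exact ⟨QuotientGroup.mk' T y, rfl⟩
    rw [this, comap_map_eq, QuotientGroup.ker_mk']
  rw [← h1, ← h2, ← relIndex_sup_right, sup_comm T, relIndex_mul_index le_sup_left]

theorem index_sq_of_free (G : Type*) [CommGroup G] [Module.Free ℤ (Additive G)]
    [Module.Finite ℤ (Additive G)] :
    (powMonoidHom 2 : G →* G).range.index = 2 ^ Module.finrank ℤ (Additive G) := by
  rw [← ModN.natCard_eq (Additive G) 2, index_eq_card]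
  refine Nat.card_congr (Quotient.congr Additive.ofMul fun a b ↦ ?_)
  rw [QuotientGroup.leftRel_apply, Submodule.quotientRel_def, ← inv_mem_iff, mul_inv_rev, inv_inv,
    ← div_eq_inv_mul]
  simp only [MonoidHom.mem_range, powMonoidHom_apply, LinearMap.mem_range, LinearMap.lsmul_apply,
    Nat.cast_ofNat, ofNat_zsmul]
  exact Additive.ofMul.exists_congr_left

theorem index_units_sq (F : Type*) [Field F] [NumberField F] :
    (powMonoidHom 2 : (𝓞 F)ˣ →* (𝓞 F)ˣ).range.index = 2 ^ (Units.rank F + 1) := by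
  rw [index_sq_eq_relIndex_mul (Units.torsion F), IsCyclic.index_powMonoidHom_range,
    ← Units.torsionOrder, Nat.gcd_eq_right (Units.even_torsionOrder F).two_dvd, pow_succ']
  · congr 1
    rw [index_sq_of_free, Units.finrank_modTorsion]
  · intro x hx
    obtain ⟨n, hn, h⟩ := isOfFinOrder_iff_pow_eq_one.mp hx
    exact isOfFinOrder_iff_pow_eq_one.mpr ⟨2 * n, by omega, by rw [pow_mul, h]⟩

/-- The rational numbers having even valuation at all primes outside `S`. -/
def evenOutside (S : Finset ℕ) : Subgroup ℚˣ where
  carrier := {a | ∀ p : ℕ, p.Prime → p ∉ S → Even (padicValRat p (a : ℚ))}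
  mul_mem' := by
    intro a b ha hb p hp hpS
    have : Fact p.Prime := ⟨hp⟩
    rw [Units.val_mul, padicValRat.mul a.ne_zero b.ne_zero]
    exact (ha p hp hpS).add (hb p hp hpS)
  one_mem' := by simp
  inv_mem' := by
    intro a ha p hp hpS
    have : Fact p.Prime := ⟨hp⟩
    simpa using (ha p hp hpS)

theorem mem_evenOutside {S : Finset ℕ} {a : ℚˣ} :
    a ∈ evenOutside S ↔ ∀ p : ℕ, p.Prime → p ∉ S → Even (padicValRat p (a : ℚ)) := Iff.rfl

theorem Nat.isSquare_of_even_padicValNat {n : ℕ} (hn : n ≠ 0)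
    (h : ∀ p : ℕ, p.Prime → Even (padicValNat p n)) : IsSquare n := by
  obtain ⟨a, b, hab, ha⟩ := Nat.sq_mul_squarefree n
  have hb0 : b ≠ 0 := by rintro rfl; simp at hab; exact hn hab.symm
  have ha0 : a ≠ 0 := ha.ne_zero
  suffices a = 1 from ⟨b, by rw [← hab, this, mul_one, sq]⟩
  by_contra h1
  obtain ⟨p, hp, hpa⟩ := Nat.exists_prime_and_dvd h1
  have : Fact p.Prime := ⟨hp⟩
  have h2 := h p hp
  rw [← hab, padicValNat.mul (pow_ne_zero _ hb0) ha0, padicValNat.pow,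
    ← Nat.factorization_def a hp, le_antisymm (ha.natFactorization_le_one p)
      (hp.factorization_pos_of_dvd ha0 hpa)] at h2
  simp at h2

theorem Rat.isSquare_of_even_padicValRat {a : ℚ} (ha : 0 < a)
    (h : ∀ p : ℕ, p.Prime → Even (padicValRat p a)) : IsSquare a := by
  have hd : (a.den : ℚ) ≠ 0 := by exact_mod_cast a.den_ne_zero
  have hz : 0 < a.num := Rat.num_pos.mpr ha
  have hn : a.num.natAbs * a.den ≠ 0 := by simp [ha.ne']
  have key : ((a.num.natAbs * a.den : ℕ) : ℚ) = a * a.den ^ 2 := by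
    have h1 : ((a.num.natAbs : ℕ) : ℚ) = a.num := by
      rw [← Int.cast_natCast, Int.natAbs_of_nonneg hz.le]
    rw [Nat.cast_mul, h1]
    nth_rewrite 3 [← Rat.num_div_den a]
    field_simp
  obtain ⟨c, hc⟩ := Nat.isSquare_of_even_padicValNat hn fun p hp ↦ by
    have : Fact p.Prime := ⟨hp⟩
    have h2 := h p hp
    have h3 := congrArg (padicValRat p) key
    rw [padicValRat.of_nat, padicValRat.mul ha.ne' (pow_ne_zero _ hd), padicValRat.pow] at h3
    rw [← Int.even_coe_nat, h3]
    exact h2.add (by simp)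
  refine ⟨c / a.den, ?_⟩
  rw [hc] at key
  push_cast at key
  field_simp
  linarith

theorem mem_evenOutside_insert {S : Finset ℕ} {p : ℕ} (hp : p.Prime) {b u : ℚˣ}
    (hu : (u : ℚ) = p) (hb : b ∈ evenOutside (insert p S)) :
    b * u ∈ evenOutside S ∨ b ∈ evenOutside S := by
  have : Fact p.Prime := ⟨hp⟩
  by_cases h : Even (padicValRat p (b : ℚ))
  · right
    intro r hr hrS
    by_cases hrp : r = p
    · exact hrp ▸ h
    · exact hb r hr (by simp [hrp, hrS])
  · left
    intro r hr hrS
    have : Fact r.Prime := ⟨hr⟩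
    rw [Units.val_mul, padicValRat.mul b.ne_zero u.ne_zero, hu, padicValRat.of_nat]
    by_cases hrp : r = p
    · subst hrp
      rw [padicValNat_self, Int.even_add, Nat.cast_one]
      simp [h]
    · rw [padicValNat_primes hrp]
      simpa using hb r hr (by simp [hrp, hrS])

theorem eq_or_eq_neg_sq_of_mem_evenOutside_empty {b : ℚˣ} (hb : b ∈ evenOutside ∅) :
    b * (-1) ∈ (powMonoidHom 2 : ℚˣ →* ℚˣ).range ∨ b ∈ (powMonoidHom 2 : ℚˣ →* ℚˣ).range := by
  have key (c : ℚˣ) (hc : c ∈ evenOutside ∅) (h : 0 < (c : ℚ)) :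
      c ∈ (powMonoidHom 2 : ℚˣ →* ℚˣ).range := by
    obtain ⟨r, hr⟩ := Rat.isSquare_of_even_padicValRat h fun p hp ↦ hc p hp (by simp)
    have : r ≠ 0 := by rintro rfl; simp at hr
    exact ⟨Units.mk0 r this, by ext; simp [hr, sq]⟩
  rcases lt_or_gt_of_ne b.ne_zero with h | h
  · left
    refine key _ (mul_mem hb ?_) (by simpa using h)
    intro p hp _
    simp
  · exact Or.inr (key b hb h)

theorem sq_le_evenOutside (S : Finset ℕ) :
    (powMonoidHom 2 : ℚˣ →* ℚˣ).range ≤ evenOutside S := by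
  rintro _ ⟨b, rfl⟩ p hp _
  have : Fact p.Prime := ⟨hp⟩
  simp [padicValRat.pow]

theorem evenOutside_le_insert (S : Finset ℕ) (p : ℕ) : evenOutside S ≤ evenOutside (insert p S) :=
  fun _ hb r hr hrS ↦ hb r hr fun h ↦ hrS (Finset.mem_insert_of_mem h)

theorem relIndex_sq_evenOutside (S : Finset ℕ) (hS : ∀ p ∈ S, p.Prime) :
    (powMonoidHom 2 : ℚˣ →* ℚˣ).range.relIndex (evenOutside S) = 2 ^ (S.card + 1) := by
  induction S using Finset.induction_on with
  | empty =>
    rw [Finset.card_empty, zero_add, pow_one, relIndex_eq_two_iff_exists_notMem_and]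
    refine ⟨-1, fun p hp _ ↦ by simp, ?_, fun b ↦ eq_or_eq_neg_sq_of_mem_evenOutside_empty⟩
    rintro ⟨b, hb⟩
    have := congrArg Units.val hb
    simp only [powMonoidHom_apply, Units.val_pow_eq_pow_val, Units.val_neg, Units.val_one] at this
    nlinarith [sq_nonneg (b : ℚ)]
  | insert p S hpS ih =>
    have hp := hS p (by simp)
    have : Fact p.Prime := ⟨hp⟩
    rw [← relIndex_mul_relIndex _ _ _ (sq_le_evenOutside S) (evenOutside_le_insert S p),
      ih fun q hq ↦ hS q (by simp [hq]), Finset.card_insert_of_notMem hpS, pow_succ]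
    congr 1
    rw [relIndex_eq_two_iff_exists_notMem_and]
    refine ⟨Units.mk0 (p : ℚ) (by exact_mod_cast hp.ne_zero), ?_, ?_,
      fun b ↦ mem_evenOutside_insert hp rfl⟩
    · intro r hr hrS
      have : Fact r.Prime := ⟨hr⟩
      have : r ≠ p := fun h ↦ hrS (by simp [h])
      simp [padicValNat_primes this]
    · intro h
      simpa using h p hp hpS

theorem evenOutside_le {S : Finset ℕ} (hS : ∀ p ∈ S, p.Prime) (A : Subgroup ℚˣ)
    (hsq : (powMonoidHom 2 : ℚˣ →* ℚˣ).range ≤ A) (hneg : -1 ∈ A)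
    (hp : ∀ p ∈ S, ∀ u : ℚˣ, (u : ℚ) = p → u ∈ A) : evenOutside S ≤ A := by
  induction S using Finset.induction_on with
  | empty =>
    intro b hb
    rcases eq_or_eq_neg_sq_of_mem_evenOutside_empty hb with h | h
    · exact (mul_mem_cancel_right hneg).mp (hsq h)
    · exact hsq h
  | insert p S hpS ih =>
    intro b hb
    have ih' := ih (fun q hq ↦ hS q (by simp [hq])) (fun q hq ↦ hp q (by simp [hq]))
    have hpp := hS p (by simp)
    rcases mem_evenOutside_insert hpp (u := Units.mk0 (p : ℚ) (by exact_mod_cast hpp.ne_zero))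
      rfl hb with h | h
    · exact (mul_mem_cancel_right (hp p (by simp) _ rfl)).mp (ih' h)
    · exact ih' h

/-- `s` is a square root of the squarefree integer `d`, and `1, s` is a `ℚ`-basis of `F`. -/
structure IsQuadraticGenerator (F : Type*) [Field F] [NumberField F] (d : ℤ) (s : F) : Prop where
  squarefree : Squarefree d
  sq_eq : s ^ 2 = d
  exists_coord : ∀ z : F, ∃ x y : ℚ, z = x + y * s
  eq_zero : ∀ x y : ℚ, (x : F) + y * s = 0 → x = 0 ∧ y = 0

theorem exists_isQuadraticGenerator (F : Type*) [Field F] [NumberField F]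
    (hdeg : Module.finrank ℚ F = 2) : ∃ (d : ℤ) (s : F), IsQuadraticGenerator F d s := by
  obtain ⟨z, hz⟩ : ∃ z : F, z ∉ (⊥ : Subalgebra ℚ F) := by
    by_contra! h
    have : (⊥ : Subalgebra ℚ F) = ⊤ := by ext; simp [h]
    rw [Subalgebra.bot_eq_top_iff_finrank_eq_one, hdeg] at this
    omega
  have hlin (w : F) (hw : w ∉ (⊥ : Subalgebra ℚ F)) : LinearIndependent ℚ ![1, w] := by
    rw [LinearIndependent.pair_iff' one_ne_zero]
    intro a ha
    exact hw (Algebra.mem_bot.mpr ⟨a, by rw [Algebra.algebraMap_eq_smul_one, ha]⟩)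
  have hspan (w : F) (hw : w ∉ (⊥ : Subalgebra ℚ F)) (v : F) : ∃ x y : ℚ, v = x + y * w := by
    have h := (hlin w hw).span_eq_top_of_card_eq_finrank' (by simp [hdeg])
    have hv : v ∈ Submodule.span ℚ (Set.range ![1, w]) := h ▸ Submodule.mem_top
    rw [Matrix.range_cons, Matrix.range_cons, Matrix.range_empty, Set.union_empty,
      Set.singleton_union, Submodule.mem_span_pair] at hv
    obtain ⟨x, y, rfl⟩ := hv
    exact ⟨x, y, by simp [Algebra.smul_def]⟩
  obtain ⟨a, b, hab⟩ := hspan z hz (z ^ 2)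
  -- complete the square, then clear denominators and square factors
  obtain ⟨w, q, hw, hwq⟩ : ∃ (w : F) (q : ℚ), w ∉ (⊥ : Subalgebra ℚ F) ∧ w ^ 2 = q := by
    refine ⟨z - (b / 2 : ℚ), a + b ^ 2 / 4, fun h ↦ hz ?_, ?_⟩
    · simpa using add_mem h ((⊥ : Subalgebra ℚ F).algebraMap_mem (b / 2 : ℚ))
    · push_cast
      linear_combination hab
  have hq : q ≠ 0 := by
    rintro rfl
    apply hw
    have : w = 0 := by simpa using hwq
    exact this ▸ zero_mem _
  obtain ⟨m, k, hmk, hm⟩ := Nat.sq_mul_squarefree (q.num * q.den).natAbs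
  have hden : (q.den : ℚ) ≠ 0 := by exact_mod_cast q.den_ne_zero
  have hk : (k : ℚ) ≠ 0 := by
    rintro h
    have : k = 0 := by exact_mod_cast h
    subst this
    simp [eq_comm, hq] at hmk
  have key : ∃ d : ℤ, Squarefree d ∧ (d : ℚ) * k ^ 2 = q * q.den ^ 2 := by
    have h1 : (q.num : ℚ) * q.den = q * q.den ^ 2 := by
      nth_rewrite 3 [← Rat.num_div_den q]
      field_simp
    refine ⟨(q.num * q.den).sign * m, ?_, ?_⟩
    · rw [← Int.squarefree_natAbs, Int.natAbs_mul, Int.natAbs_sign_of_ne_zero (by simp [hq])]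
      simpa using hm
    · rw [← h1]
      have h2 := Int.sign_mul_natAbs (q.num * q.den)
      rw [← hmk] at h2
      push_cast at h2
      have h3 := congrArg (Int.cast (R := ℚ)) h2
      push_cast at h3 ⊢
      linear_combination h3
  obtain ⟨d, hd, hdk⟩ := key
  have hc : ((q.den : ℚ) / k) ≠ 0 := div_ne_zero hden hk
  have hs : ((q.den : ℚ) / k : ℚ) * w ∉ (⊥ : Subalgebra ℚ F) := by
    intro h
    apply hw
    have := mul_mem ((⊥ : Subalgebra ℚ F).algebraMap_mem ((q.den : ℚ) / k)⁻¹) h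
    rwa [eq_ratCast, ← mul_assoc, ← Rat.cast_mul, inv_mul_cancel₀ hc, Rat.cast_one, one_mul] at this
  refine ⟨d, ((q.den : ℚ) / k : ℚ) * w, hd, ?_, hspan _ hs, fun x y h ↦ ?_⟩
  · rw [mul_pow, hwq, ← Rat.cast_pow, ← Rat.cast_mul, ← Rat.cast_intCast]
    congr 1
    field_simp
    linarith
  · exact LinearIndependent.pair_iff.mp (hlin _ hs) x y (by simpa [Algebra.smul_def] using h)

namespace IsQuadraticGenerator

variable {F : Type*} [Field F] [NumberField F] {d : ℤ} {s : F}

theorem d_ne_zero (h : IsQuadraticGenerator F d s) : d ≠ 0 := h.squarefree.ne_zero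

theorem not_sq (h : IsQuadraticGenerator F d s) (q : ℚ) : q ^ 2 ≠ d := by
  intro hq
  have h1 : (s - q) * (s + q) = 0 := by
    have : (q : F) ^ 2 = d := by exact_mod_cast congrArg (Rat.cast (K := F)) hq
    linear_combination h.sq_eq - this
  rcases mul_eq_zero.mp h1 with h2 | h2
  · have := h.eq_zero (-q) 1 (by push_cast; linear_combination h2)
    simp at this
  · have := h.eq_zero q 1 (by push_cast; linear_combination h2)
    simp at this

theorem linearIndependent (h : IsQuadraticGenerator F d s) : LinearIndependent ℚ ![1, s] :=
  LinearIndependent.pair_iff.mpr fun x y hxy ↦ h.eq_zero x y (by simpa [Algebra.smul_def] using hxy)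

/-- The `ℚ`-basis `1, s`. -/
noncomputable def basis (h : IsQuadraticGenerator F d s) : Module.Basis (Fin 2) ℚ F :=
  .mk h.linearIndependent (by
    intro z _
    rw [Matrix.range_cons, Matrix.range_cons, Matrix.range_empty, Set.union_empty,
      Set.singleton_union, Submodule.mem_span_pair]
    obtain ⟨x, y, rfl⟩ := h.exists_coord z
    exact ⟨x, y, by simp [Algebra.smul_def]⟩)

theorem leftMulMatrix_basis (h : IsQuadraticGenerator F d s) (x y : ℚ) :
    Algebra.leftMulMatrix h.basis (x + y * s) = !![x, y * d; y, x] := by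
  have h0 : h.basis 0 = 1 := by simp [basis]
  have h1 : h.basis 1 = s := by simp [basis]
  have hr (a b : ℚ) : h.basis.repr (a + b * s) = Finsupp.single 0 a + Finsupp.single 1 b := by
    have : (a : F) + b * s = a • h.basis 0 + b • h.basis 1 := by simp [h0, h1, Algebra.smul_def]
    rw [this, map_add, map_smul, map_smul, h.basis.repr_self, h.basis.repr_self]
    simp
  ext i j
  rw [Algebra.leftMulMatrix_eq_repr_mul]
  have h2 : ((x : F) + y * s) * s = ((y * d : ℚ) : F) + (x : ℚ) * s := by
    push_cast; linear_combination (y : F) * h.sq_eq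
  fin_cases j
  · simp only [Fin.zero_eta, h0, mul_one, hr]
    fin_cases i <;> simp
  · simp only [Fin.mk_one, h1, h2, hr]
    fin_cases i <;> simp

theorem norm_eq (h : IsQuadraticGenerator F d s) (x y : ℚ) :
    Algebra.norm ℚ ((x : F) + y * s) = x ^ 2 - d * y ^ 2 := by
  rw [Algebra.norm_eq_matrix_det h.basis, leftMulMatrix_basis, Matrix.det_fin_two_of]
  ring

theorem trace_eq (h : IsQuadraticGenerator F d s) (x y : ℚ) :
    Algebra.trace ℚ F ((x : F) + y * s) = 2 * x := by
  rw [Algebra.trace_eq_matrix_trace h.basis, leftMulMatrix_basis, Matrix.trace_fin_two_of]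
  ring

theorem finrank_eq (h : IsQuadraticGenerator F d s) : Module.finrank ℚ F = 2 := by
  simpa using Module.finrank_eq_card_basis h.basis

theorem exists_discr_mul_sq (h : IsQuadraticGenerator F d s) :
    ∃ m : ℤ, 4 * d = m ^ 2 * discr F := by
  have hs : IsIntegral ℤ s := by
    refine IsIntegral.of_pow two_pos ?_
    rw [h.sq_eq]
    simpa using (isIntegral_algebraMap : IsIntegral ℤ (algebraMap ℤ F d))
  obtain ⟨t, rfl⟩ : ∃ t : 𝓞 F, (t : F) = s := ⟨⟨s, hs⟩, rfl⟩
  have hcard : Fintype.card (Module.Free.ChooseBasisIndex ℤ (𝓞 F)) = 2 := by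
    rw [← Module.finrank_eq_card_chooseBasisIndex, RingOfIntegers.rank, h.finrank_eq]
  let b := (RingOfIntegers.basis F).reindex (Fintype.equivFinOfCardEq hcard)
  have h1 : Algebra.discr ℤ ![1, t] = (b.toMatrix ![1, t]).det ^ 2 * Algebra.discr ℤ b := by
    rw [← Algebra.discr_of_matrix_vecMul, Module.Basis.toMatrix_map_vecMul]
  have htr (a b : ℤ) : Algebra.trace ℤ (𝓞 F) (a + b * t) = 2 * a := by
    have := Algebra.coe_trace_int (K := F) (a + b * t : 𝓞 F)
    have h2 := h.trace_eq a b
    have h3 : ((Algebra.trace ℤ (𝓞 F) (a + b * t) : ℤ) : ℚ) = 2 * a := by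
      rw [this, ← h2]; simp
    exact_mod_cast h3
  have htt : t * t = d := by
    apply RingOfIntegers.coe_injective
    simpa [sq] using h.sq_eq
  have t1 : Algebra.trace ℤ (𝓞 F) 1 = 2 := by simpa using htr 1 0
  have t2 : Algebra.trace ℤ (𝓞 F) t = 0 := by simpa using htr 0 1
  have t3 : Algebra.trace ℤ (𝓞 F) (d : 𝓞 F) = 2 * d := by simpa using htr d 0
  refine ⟨(b.toMatrix ![1, t]).det, ?_⟩
  rw [discr_eq_discr F b] at h1
  rw [← h1, Algebra.discr_def, Matrix.det_fin_two]
  simp [Algebra.traceMatrix_apply, Algebra.traceForm_apply, htt, t1, t2, t3]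
  ring

theorem dvd_discr_iff (h : IsQuadraticGenerator F d s) {p : ℕ} (hp : p.Prime) (hp2 : p ≠ 2) :
    (p : ℤ) ∣ discr F ↔ (p : ℤ) ∣ d := by
  obtain ⟨m, hm⟩ := h.exists_discr_mul_sq
  have hpi := Nat.prime_iff_prime_int.mp hp
  have h4 : ¬ (p : ℤ) ∣ 4 := by
    intro h4
    have h4 : p ∣ 2 ^ 2 := by exact_mod_cast h4
    exact hp2 ((Nat.prime_dvd_prime_iff_eq hp Nat.prime_two).mp (hp.dvd_of_dvd_pow h4))
  constructor
  · intro hD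
    exact (hpi.dvd_or_dvd (hm ▸ hD.mul_left _ : (p : ℤ) ∣ 4 * d)).resolve_left h4
  · intro hd
    rcases hpi.dvd_or_dvd (hm ▸ hd.mul_left 4 : (p : ℤ) ∣ m ^ 2 * discr F) with h1 | h1
    · exfalso
      obtain ⟨k, rfl⟩ := hpi.dvd_of_dvd_pow h1
      obtain ⟨e, rfl⟩ := hd
      have : (p : ℤ) ∣ 4 * e := by
        refine ⟨k ^ 2 * discr F, mul_left_cancel₀ hpi.ne_zero ?_⟩
        linear_combination hm
      obtain ⟨e', rfl⟩ := (hpi.dvd_or_dvd this).resolve_left h4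
      have := h.squarefree p ⟨e', by ring⟩
      exact hpi.not_isUnit this
    · exact h1

end IsQuadraticGenerator

theorem FractionalIdeal.pow_left_injective_units (R K : Type*) [CommRing R] [IsDedekindDomain R]
    [Field K] [Algebra R K] [IsFractionRing R K] {n : ℕ} (hn : n ≠ 0) :
    Function.Injective (powMonoidHom n : (FractionalIdeal R⁰ K)ˣ →* (FractionalIdeal R⁰ K)ˣ) := by
  intro I J h
  ext1
  rw [← finprod_heightOneSpectrum_factorization' K I.ne_zero,
    ← finprod_heightOneSpectrum_factorization' K J.ne_zero]
  refine finprod_congr fun v ↦ ?_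
  have h1 : (I : FractionalIdeal R⁰ K) ^ n = (J : FractionalIdeal R⁰ K) ^ n :=
    congrArg Units.val h
  have h2 := congrArg (count K v) h1
  rw [count_pow, count_pow] at h2
  rw [mul_left_cancel₀ (by exact_mod_cast hn) h2]

/-- The elements of `Fˣ` generating the square of a fractional ideal. -/
noncomputable def idealSquares (F : Type*) [Field F] [NumberField F] : Subgroup Fˣ :=
  (powMonoidHom 2 : (FractionalIdeal (𝓞 F)⁰ F)ˣ →* (FractionalIdeal (𝓞 F)⁰ F)ˣ).range.comap
    (toPrincipalIdeal (𝓞 F) F)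

section

variable {F : Type*} [Field F] [NumberField F]

theorem mem_idealSquares {a : Fˣ} : a ∈ idealSquares F ↔
    ∃ I : (FractionalIdeal (𝓞 F)⁰ F)ˣ,
      (I : FractionalIdeal (𝓞 F)⁰ F) ^ 2 = FractionalIdeal.spanSingleton (𝓞 F)⁰ (a : F) := by
  simp only [idealSquares, mem_comap, MonoidHom.mem_range, powMonoidHom_apply, Units.ext_iff,
    Units.val_pow_eq_pow_val, coe_toPrincipalIdeal]

theorem sq_le_idealSquares : (powMonoidHom 2 : Fˣ →* Fˣ).range ≤ idealSquares F := by
  rintro _ ⟨a, rfl⟩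
  exact ⟨toPrincipalIdeal (𝓞 F) F a, by simp⟩

theorem ker_toPrincipalIdeal_le : (toPrincipalIdeal (𝓞 F) F).ker ≤ idealSquares F := by
  intro a ha
  exact ⟨1, by simpa using ha.symm⟩

theorem ker_toPrincipalIdeal :
    (toPrincipalIdeal (𝓞 F) F).ker = (Units.map (algebraMap (𝓞 F) F : 𝓞 F →* F)).range := by
  ext a
  rw [MonoidHom.mem_ker, toPrincipalIdeal_eq_iff, Units.val_one]
  constructor
  · intro h
    have h1 : (a : F) ∈ (1 : FractionalIdeal (𝓞 F)⁰ F) :=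
      h ▸ FractionalIdeal.mem_spanSingleton_self _ _
    have h2 : (a : F)⁻¹ ∈ (1 : FractionalIdeal (𝓞 F)⁰ F) := by
      rw [← inv_one, ← h, FractionalIdeal.spanSingleton_inv]
      exact FractionalIdeal.mem_spanSingleton_self _ _
    rw [FractionalIdeal.mem_one_iff] at h1 h2
    obtain ⟨x, hx⟩ := h1
    obtain ⟨y, hy⟩ := h2
    have hxy : x * y = 1 := by
      apply FaithfulSMul.algebraMap_injective (𝓞 F) F
      rw [map_mul, hx, hy, map_one, mul_inv_cancel₀ a.ne_zero]
    exact ⟨⟨x, y, hxy, by rw [mul_comm, hxy]⟩, by ext; exact hx⟩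
  · rintro ⟨u, rfl⟩
    rw [Units.coe_map, MonoidHom.coe_coe, ← FractionalIdeal.coeIdeal_span_singleton,
      Ideal.span_singleton_eq_top.mpr u.isUnit, FractionalIdeal.coeIdeal_top]

theorem relIndex_sq_ker_toPrincipalIdeal :
    (powMonoidHom 2 : Fˣ →* Fˣ).range.relIndex (toPrincipalIdeal (𝓞 F) F).ker =
      2 ^ (Units.rank F + 1) := by
  rw [ker_toPrincipalIdeal, ← index_units_sq, ← index_comap]
  congr 1
  ext u
  constructor
  · rintro ⟨a, ha⟩
    have ha' : (a : F) ^ 2 = (u : 𝓞 F) := congrArg Units.val ha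
    have h_integral (b : F) (v : (𝓞 F)ˣ) (h : b ^ 2 = (v : 𝓞 F)) : IsIntegral ℤ b :=
      IsIntegral.of_pow two_pos (h ▸ RingOfIntegers.isIntegral_coe _)
    have h2 : ((a⁻¹ : Fˣ) : F) ^ 2 = ((u⁻¹ : (𝓞 F)ˣ) : 𝓞 F) := by
      have := congrArg Units.val (congrArg (·⁻¹) ha)
      simpa using this
    obtain ⟨x, hx⟩ : ∃ x : 𝓞 F, (x : F) = a := ⟨⟨a, h_integral _ _ ha'⟩, rfl⟩
    obtain ⟨y, hy⟩ : ∃ x : 𝓞 F, (x : F) = (a⁻¹ : Fˣ) := ⟨⟨_, h_integral _ _ h2⟩, rfl⟩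
    have hxy : x * y = 1 := by
      apply RingOfIntegers.coe_injective
      simp [hx, hy]
    refine ⟨⟨x, y, hxy, by rw [mul_comm, hxy]⟩, ?_⟩
    ext
    simp [hx, ha']
  · rintro ⟨v, rfl⟩
    exact ⟨Units.map (algebraMap (𝓞 F) F : 𝓞 F →* F) v, by simp⟩

theorem card_sq_eq_one_mul_eq :
    Nat.card {x : ClassGroup (𝓞 F) // x ^ 2 = 1} * 2 ^ (Units.rank F + 1) =
      (powMonoidHom 2 : Fˣ →* Fˣ).range.relIndex (idealSquares F) := by
  have hsurj : Function.Surjective (ClassGroup.mk (R := 𝓞 F) F) := by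
    exact fun x ↦ ClassGroup.induction F (fun I ↦ ⟨I, rfl⟩) x
  have hker : (ClassGroup.mk (R := 𝓞 F) F).ker = (toPrincipalIdeal (𝓞 F) F).range := by
    ext I
    rw [MonoidHom.mem_ker, ClassGroup.mk_eq_one_iff, mem_principal_ideals_iff]
    rw [FractionalIdeal.isPrincipal_iff]
    simp only [eq_comm]
  have h1 := card_sq_eq_one_of_exact (toPrincipalIdeal (𝓞 F) F) (ClassGroup.mk F) hsurj hker
    (FractionalIdeal.pow_left_injective_units (𝓞 F) F two_ne_zero)
  have h2 := relIndex_mul_relIndex (powMonoidHom 2 : Fˣ →* Fˣ).range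
    ((toPrincipalIdeal (𝓞 F) F).ker ⊔ (powMonoidHom 2 : Fˣ →* Fˣ).range) (idealSquares F)
    le_sup_right (sup_le ker_toPrincipalIdeal_le sq_le_idealSquares)
  rw [h1, ← relIndex_sq_ker_toPrincipalIdeal, ← h2, relIndex_sup_right, mul_comm]
  rfl

end

section

theorem FractionalIdeal.count_coeIdeal_eq_zero {R : Type*} [CommRing R] [IsDedekindDomain R]
    (K : Type*) [Field K] [Algebra R K] [IsFractionRing R K] (v : HeightOneSpectrum R)
    {J : Ideal R} (hJ : J ≠ 0) (h : ¬ J ≤ v.asIdeal) :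
    count K v (J : FractionalIdeal R⁰ K) = 0 := by
  classical
  rw [count_coe K v hJ, Nat.cast_eq_zero]
  by_contra h0
  exact h (Ideal.dvd_iff_le.mp ((Associates.count_ne_zero_iff_dvd hJ v.irreducible).mp h0))

theorem FractionalIdeal.count_coeIdeal_eq_one {R : Type*} [CommRing R] [IsDedekindDomain R]
    (K : Type*) [Field K] [Algebra R K] [IsFractionRing R K] (v : HeightOneSpectrum R)
    {I : Ideal R} (hI : I ≠ 0) (h1 : I ≤ v.asIdeal) (h2 : ¬ I ≤ v.asIdeal ^ 2) :
    count K v (I : FractionalIdeal R⁰ K) = 1 := by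
  obtain ⟨J, rfl⟩ := Ideal.dvd_iff_le.mpr h1
  have hJ : J ≠ 0 := right_ne_zero_of_mul hI
  rw [coeIdeal_mul, count_mul _ _ (coeIdeal_ne_zero.mpr v.ne_bot) (coeIdeal_ne_zero.mpr hJ),
    count_self, count_coeIdeal_eq_zero K v hJ, add_zero]
  intro hJv
  exact h2 (sq v.asIdeal ▸ Ideal.mul_mono_right hJv)

variable {F : Type*} [Field F] [NumberField F]

theorem isUnramifiedAt_iff_not_le_sq {p : ℕ} (hp : p.Prime) {P : Ideal (𝓞 F)} [P.IsPrime]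
    (hP : (p : 𝓞 F) ∈ P) :
    Algebra.IsUnramifiedAt ℤ P ↔ ¬ Ideal.span {(p : 𝓞 F)} ≤ P ^ 2 := by
  have hpi := Nat.prime_iff_prime_int.mp hp
  have hmap : (Ideal.span {(p : ℤ)}).map (algebraMap ℤ (𝓞 F)) = Ideal.span {(p : 𝓞 F)} := by
    simp [Ideal.map_span]
  have hle : (Ideal.span {(p : ℤ)}).map (algebraMap ℤ (𝓞 F)) ≤ P := by
    rw [hmap, Ideal.span_singleton_le_iff_mem]
    exact hP
  have : P.LiesOver (Ideal.span {(p : ℤ)}) :=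
    (Ideal.liesOver_span_iff Ideal.IsPrime.ne_top' hpi).mpr (by simpa using hP)
  rw [← Ideal.ramificationIdx_eq_one_iff, ← Ideal.ramificationIdx'_eq_ramificationIdx
    (Ideal.span {(p : ℤ)}) P (by simpa using hp.ne_zero), ← hmap,
    ← Ideal.ramificationIdx'_ne_one_iff hle, not_ne_iff]

theorem not_dvd_discr_iff_forall_not_le_sq {p : ℕ} (hp : p.Prime) :
    ¬ (p : ℤ) ∣ discr F ↔ ∀ v : HeightOneSpectrum (𝓞 F), (p : 𝓞 F) ∈ v.asIdeal →
      ¬ Ideal.span {(p : 𝓞 F)} ≤ v.asIdeal ^ 2 := by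
  rw [not_dvd_discr_iff_forall_mem F (𝓞 F) (Nat.prime_iff_prime_int.mp hp)]
  constructor
  · intro h v hv
    exact (isUnramifiedAt_iff_not_le_sq hp hv).mp (h v.asIdeal v.isPrime (by simpa using hv))
  · intro h P hP hpP
    have hpP : (p : 𝓞 F) ∈ P := by simpa using hpP
    have hne : P ≠ ⊥ := by
      rintro rfl
      simp [hp.ne_zero] at hpP
    exact (isUnramifiedAt_iff_not_le_sq hp hpP).mpr (h ⟨P, hP, hne⟩ hpP)

theorem exists_mem_heightOneSpectrum {p : ℕ} (hp : p.Prime) :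
    ∃ v : HeightOneSpectrum (𝓞 F), (p : 𝓞 F) ∈ v.asIdeal := by
  have hu : ¬ IsUnit (p : 𝓞 F) := by
    intro h
    have h1 := (Ideal.absNorm_eq_one_iff (I := Ideal.span {(p : 𝓞 F)})).mpr
      (Ideal.span_singleton_eq_top.mpr h)
    have h2 := Algebra.norm_algebraMap (S := 𝓞 F) (p : ℤ)
    rw [map_natCast] at h2
    rw [Ideal.absNorm_span_singleton, h2, Int.natAbs_pow, Int.natAbs_natCast,
      Nat.pow_eq_one, RingOfIntegers.rank] at h1
    exact h1.elim hp.ne_one (Module.finrank_pos (R := ℚ) (M := F)).ne'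
  obtain ⟨P, hP, hle⟩ := Ideal.exists_le_maximal _ (mt Ideal.span_singleton_eq_top.mp hu)
  have hmem : (p : 𝓞 F) ∈ P := hle (Ideal.mem_span_singleton_self _)
  refine ⟨⟨P, hP.isPrime, ?_⟩, hmem⟩
  rintro rfl
  simp [hp.ne_zero] at hmem

theorem count_spanSingleton_intCast {p : ℕ} (hp : p.Prime) (v : HeightOneSpectrum (𝓞 F))
    (hv : (p : 𝓞 F) ∈ v.asIdeal) (h2 : ¬ Ideal.span {(p : 𝓞 F)} ≤ v.asIdeal ^ 2)
    {z : ℤ} (hz : z ≠ 0) :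
    FractionalIdeal.count F v (FractionalIdeal.spanSingleton (𝓞 F)⁰ (z : F)) =
      padicValInt p z := by
  have : Fact p.Prime := ⟨hp⟩
  have hpi := Nat.prime_iff_prime_int.mp hp
  have hcoe (a : ℤ) : FractionalIdeal.spanSingleton (𝓞 F)⁰ (a : F) =
      (Ideal.span {(a : 𝓞 F)} : Ideal (𝓞 F)) := by
    rw [FractionalIdeal.coeIdeal_span_singleton, map_intCast]
  obtain ⟨c, hc, hpc⟩ := (Int.finiteMultiplicity_iff.mpr
    ⟨by simpa using hp.ne_one, hz⟩ : FiniteMultiplicity (p : ℤ) z).exists_eq_pow_mul_and_not_dvd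
  set n := multiplicity (p : ℤ) z
  have hc0 : c ≠ 0 := by rintro rfl; simp at hpc
  have h3 : padicValInt p z = n := by
    rw [hc, padicValInt.mul (pow_ne_zero _ hpi.ne_zero) hc0, padicValInt.eq_zero_of_not_dvd hpc]
    simp [padicValInt, Int.natAbs_pow]
  have hp1 : FractionalIdeal.count F v
      (FractionalIdeal.spanSingleton (𝓞 F)⁰ ((p : ℤ) : F)) = 1 := by
    rw [hcoe]
    apply FractionalIdeal.count_coeIdeal_eq_one
    · simp [hp.ne_zero]
    · simpa [Ideal.span_singleton_le_iff_mem] using hv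
    · simpa using h2
  have hc1 : FractionalIdeal.count F v (FractionalIdeal.spanSingleton (𝓞 F)⁰ (c : F)) = 0 := by
    rw [hcoe]
    apply FractionalIdeal.count_coeIdeal_eq_zero
    · simp [hc0]
    · rw [Ideal.span_singleton_le_iff_mem]
      intro hcv
      obtain ⟨a, b, hab⟩ := (hpi.coprime_iff_not_dvd.mpr hpc)
      apply v.isPrime.ne_top
      rw [Ideal.eq_top_iff_one]
      have : (1 : 𝓞 F) = a * p + b * c := by exact_mod_cast hab.symm
      rw [this]
      exact add_mem (Ideal.mul_mem_left _ _ hv) (Ideal.mul_mem_left _ _ hcv)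
  have hne (a : ℤ) (ha : a ≠ 0) : FractionalIdeal.spanSingleton (𝓞 F)⁰ (a : F) ≠ 0 :=
    FractionalIdeal.spanSingleton_ne_zero_iff.mpr (Int.cast_ne_zero.mpr ha)
  rw [h3, hc, Int.cast_mul, Int.cast_pow, ← FractionalIdeal.spanSingleton_mul_spanSingleton,
    ← FractionalIdeal.spanSingleton_pow, FractionalIdeal.count_mul _ _
      (pow_ne_zero _ (hne _ hpi.ne_zero)) (hne _ hc0), FractionalIdeal.count_pow, hp1, hc1]
  simp

theorem comap_idealSquares (hdeg : Module.finrank ℚ F = 2) :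
    (idealSquares F).comap (Units.map (algebraMap ℚ F : ℚ →* F)) =
      evenOutside (discr F).natAbs.primeFactors := by
  apply le_antisymm
  · intro a ha p hp hpS
    have : Fact p.Prime := ⟨hp⟩
    have hpD : ¬ (p : ℤ) ∣ discr F := by
      intro h
      exact hpS (Nat.mem_primeFactors.mpr
        ⟨hp, Int.natCast_dvd.mp h, by simpa using discr_ne_zero F⟩)
    obtain ⟨v, hv⟩ := exists_mem_heightOneSpectrum (F := F) hp
    have h2 := (not_dvd_discr_iff_forall_not_le_sq hp).mp hpD v hv
    obtain ⟨I, hI⟩ := mem_idealSquares.mp ha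
    have hnum : (a : ℚ).num ≠ 0 := by simp
    have hden : ((a : ℚ).den : ℤ) ≠ 0 := by simp
    have key : (I : FractionalIdeal (𝓞 F)⁰ F) ^ 2 *
        FractionalIdeal.spanSingleton (𝓞 F)⁰ (((a : ℚ).den : ℤ) : F) =
        FractionalIdeal.spanSingleton (𝓞 F)⁰ ((a : ℚ).num : F) := by
      rw [hI, FractionalIdeal.spanSingleton_mul_spanSingleton]
      congr 1
      rw [Units.coe_map, MonoidHom.coe_coe, eq_ratCast, Int.cast_natCast, ← Rat.cast_natCast,
        ← Rat.cast_intCast, ← Rat.cast_mul, Rat.mul_den_eq_num]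
    have := congrArg (FractionalIdeal.count F v) key
    rw [count_spanSingleton_intCast hp v hv h2 hnum, FractionalIdeal.count_mul _ _
      (pow_ne_zero _ I.ne_zero)
      (FractionalIdeal.spanSingleton_ne_zero_iff.mpr (Int.cast_ne_zero.mpr hden)),
      count_spanSingleton_intCast hp v hv h2 hden,
      FractionalIdeal.count_pow] at this
    rw [padicValRat_def]
    refine ⟨FractionalIdeal.count F v (I : FractionalIdeal (𝓞 F)⁰ F), ?_⟩
    rw [← this, padicValInt]
    simp
    ring
  · apply evenOutside_le (fun p hp ↦ Nat.prime_of_mem_primeFactors hp)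
    · rintro _ ⟨a, rfl⟩
      exact sq_le_idealSquares ⟨Units.map (algebraMap ℚ F : ℚ →* F) a, by simp⟩
    · apply ker_toPrincipalIdeal_le
      rw [ker_toPrincipalIdeal]
      exact ⟨-1, by ext; simp⟩
    · intro p hp u hu
      obtain ⟨hp, hpD, -⟩ := Nat.mem_primeFactors.mp hp
      have := mt (not_dvd_discr_iff_forall_not_le_sq (F := F) hp).mpr
        (not_not.mpr (Int.natCast_dvd.mpr hpD))
      push Not at this
      obtain ⟨v, hv, hle⟩ := this
      have hn : Ideal.absNorm (Ideal.span {(p : 𝓞 F)}) = p ^ 2 := by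
        have h2 := Algebra.norm_algebraMap (S := 𝓞 F) (p : ℤ)
        rw [map_natCast, RingOfIntegers.rank, hdeg] at h2
        rw [Ideal.absNorm_span_singleton, h2, Int.natAbs_pow, Int.natAbs_natCast]
      have hpv : v.asIdeal ^ 2 = Ideal.span {(p : 𝓞 F)} := by
        obtain ⟨J, hJ⟩ := Ideal.dvd_iff_le.mpr hle
        have h3 := hJ ▸ hn
        rw [map_mul, map_pow] at h3
        have h4 : Ideal.absNorm v.asIdeal = p := by
          have h5 : Ideal.absNorm v.asIdeal ∣ p :=
            (Nat.pow_dvd_pow_iff two_ne_zero).mp ⟨_, h3.symm⟩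
          refine (hp.eq_one_or_self_of_dvd _ h5).resolve_left fun h6 ↦ ?_
          exact v.isPrime.ne_top (Ideal.absNorm_eq_one_iff.mp h6)
        rw [h4] at h3
        have h5 : Ideal.absNorm J = 1 := by
          simpa [hp.ne_zero] using h3
        rw [hJ, Ideal.absNorm_eq_one_iff.mp h5, Ideal.mul_top]
      rw [mem_comap, mem_idealSquares]
      refine ⟨Units.mk0 (v.asIdeal : FractionalIdeal (𝓞 F)⁰ F)
        (FractionalIdeal.coeIdeal_ne_zero.mpr v.ne_bot), ?_⟩
      rw [Units.val_mk0, ← FractionalIdeal.coeIdeal_pow, hpv,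
        FractionalIdeal.coeIdeal_span_singleton]
      simp [hu]

end

/-- The elements of positive norm generating the square of a fractional ideal. -/
noncomputable def positiveIdealSquares (F : Type*) [Field F] [NumberField F] : Subgroup Fˣ :=
  idealSquares F ⊓ (Units.posSubgroup ℚ).comap (Units.map (Algebra.norm ℚ : F →* ℚ))

section

variable {F : Type*} [Field F] [NumberField F]

theorem mem_positiveIdealSquares {a : Fˣ} :
    a ∈ positiveIdealSquares F ↔ a ∈ idealSquares F ∧ 0 < Algebra.norm ℚ (a : F) := by
  simp [positiveIdealSquares]

theorem exists_abs_norm_eq_sq {a : Fˣ} (ha : a ∈ idealSquares F) :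
    ∃ r : ℚ, r ≠ 0 ∧ |Algebra.norm ℚ (a : F)| = r ^ 2 := by
  obtain ⟨I, hI⟩ := mem_idealSquares.mp ha
  refine ⟨FractionalIdeal.absNorm (I : FractionalIdeal (𝓞 F)⁰ F), ?_, ?_⟩
  · rw [Ne, FractionalIdeal.absNorm_eq_zero_iff]
    exact I.ne_zero
  · rw [← map_pow, hI, FractionalIdeal.absNorm_span_singleton]

theorem sq_le_positiveIdealSquares :
    (powMonoidHom 2 : Fˣ →* Fˣ).range ≤ positiveIdealSquares F := by
  rintro _ ⟨a, rfl⟩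
  refine mem_positiveIdealSquares.mpr ⟨sq_le_idealSquares ⟨a, rfl⟩, ?_⟩
  rw [powMonoidHom_apply, Units.val_pow_eq_pow_val, map_pow]
  exact sq_pos_of_ne_zero (Algebra.norm_ne_zero_iff.mpr a.ne_zero)

namespace IsQuadraticGenerator

variable {d : ℤ} {s : F}

theorem norm_ratCast (h : IsQuadraticGenerator F d s) (q : ℚ) :
    Algebra.norm ℚ (q : F) = q ^ 2 := by
  simpa using h.norm_eq q 0

theorem sq_sub_trace_mul (h : IsQuadraticGenerator F d s) (x y : ℚ) :
    ((x : F) + y * s) ^ 2 = (2 * x : ℚ) * (x + y * s) - (x ^ 2 - d * y ^ 2 : ℚ) := by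
  push_cast
  linear_combination (y : F) ^ 2 * h.sq_eq

theorem exists_eq_ratCast_mul_sq (h : IsQuadraticGenerator F d s) {a : Fˣ} {r : ℚ} (hr : r ≠ 0)
    (ha : Algebra.norm ℚ (a : F) = r ^ 2) :
    ∃ (c : ℚˣ) (b : Fˣ), a = Units.map (algebraMap ℚ F : ℚ →* F) c * b ^ 2 := by
  have hrF : (r : F) ≠ 0 := Rat.cast_ne_zero.mpr hr
  obtain ⟨g, hg⟩ : ∃ g : F, (a : F) = r * g := ⟨a / r, by field_simp⟩
  obtain ⟨x, y, rfl⟩ := h.exists_coord g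
  have h1 : x ^ 2 - d * y ^ 2 = 1 := by
    rw [hg, map_mul, h.norm_ratCast, h.norm_eq] at ha
    exact mul_left_cancel₀ (pow_ne_zero 2 hr) (ha.trans (mul_one _).symm)
  have h2 := h.sq_sub_trace_mul x y
  rw [h1] at h2
  set g := (x : F) + y * s
  by_cases hg1 : 1 + g = 0
  · refine ⟨Units.mk0 (-r) (neg_ne_zero.mpr hr), 1, ?_⟩
    ext
    simp [hg, eq_neg_of_add_eq_zero_right hg1]
  · have h3 : (1 + g) ^ 2 = (2 + 2 * x : ℚ) * g := by
      push_cast at h2 ⊢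
      linear_combination h2
    have hx : 2 + 2 * x ≠ 0 := by
      intro hx
      rw [hx] at h3
      simp [hg1] at h3
    have hxF : ((2 + 2 * x : ℚ) : F) ≠ 0 := Rat.cast_ne_zero.mpr hx
    refine ⟨Units.mk0 (r / (2 + 2 * x)) (div_ne_zero hr hx), Units.mk0 (1 + g) hg1, ?_⟩
    ext
    simp only [Units.val_mul, Units.coe_map, Units.val_mk0, Units.val_pow_eq_pow_val, h3,
      MonoidHom.coe_coe, eq_ratCast, Rat.cast_div]
    rw [hg, ← mul_assoc, div_mul_cancel₀ _ hxF]

theorem positiveIdealSquares_eq (h : IsQuadraticGenerator F d s) :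
    positiveIdealSquares F =
      ((idealSquares F).comap (Units.map (algebraMap ℚ F : ℚ →* F))).map
        (Units.map (algebraMap ℚ F : ℚ →* F)) ⊔ (powMonoidHom 2 : Fˣ →* Fˣ).range := by
  apply le_antisymm
  · intro a ha
    obtain ⟨haI, hapos⟩ := mem_positiveIdealSquares.mp ha
    obtain ⟨r, hr, har⟩ := exists_abs_norm_eq_sq haI
    rw [abs_of_pos hapos] at har
    obtain ⟨c, b, rfl⟩ := h.exists_eq_ratCast_mul_sq hr har
    have hb : b ^ 2 ∈ (powMonoidHom 2 : Fˣ →* Fˣ).range := ⟨b, rfl⟩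
    refine mul_mem_sup (mem_map_of_mem _ ?_) hb
    exact (mul_mem_cancel_right (sq_le_idealSquares hb)).mp haI
  · refine sup_le ?_ sq_le_positiveIdealSquares
    rintro _ ⟨c, hc, rfl⟩
    refine mem_positiveIdealSquares.mpr ⟨hc, ?_⟩
    rw [Units.coe_map, MonoidHom.coe_coe, eq_ratCast, h.norm_ratCast]
    exact sq_pos_of_ne_zero c.ne_zero

theorem relIndex_sq_comap_sq (h : IsQuadraticGenerator F d s) :
    (powMonoidHom 2 : ℚˣ →* ℚˣ).range.relIndex
      ((powMonoidHom 2 : Fˣ →* Fˣ).range.comap (Units.map (algebraMap ℚ F : ℚ →* F))) = 2 := by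
  have hd : (d : ℚ) ≠ 0 := Int.cast_ne_zero.mpr h.d_ne_zero
  have hs : s ≠ 0 := by
    rintro rfl
    have := h.sq_eq
    simp [eq_comm, h.d_ne_zero] at this
  rw [relIndex_eq_two_iff_exists_notMem_and]
  refine ⟨Units.mk0 d hd, ⟨Units.mk0 s hs, ?_⟩, ?_, ?_⟩
  · ext; simp [h.sq_eq]
  · rintro ⟨q, hq⟩
    exact h.not_sq q (congrArg Units.val hq)
  · rintro b ⟨z, hz⟩
    obtain ⟨x, y, hxy⟩ := h.exists_coord (z : F)
    have hz : (z : F) ^ 2 = (b : ℚ) := by simpa using congrArg Units.val hz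
    rw [hxy] at hz
    obtain ⟨h1, h2⟩ := h.eq_zero (x ^ 2 + d * y ^ 2 - b) (2 * x * y) (by
      push_cast
      linear_combination hz - (y : F) ^ 2 * h.sq_eq)
    have h2 : x = 0 ∨ y = 0 := by simpa using h2
    rcases h2 with rfl | rfl
    · left
      have hy : y ≠ 0 := by rintro rfl; simp at h1
      refine ⟨Units.mk0 (d * y) (mul_ne_zero hd hy), ?_⟩
      ext
      simp only [powMonoidHom_apply, Units.val_pow_eq_pow_val, Units.val_mk0, Units.val_mul]
      linear_combination (d : ℚ) * h1
    · right
      have hx : x ≠ 0 := by rintro rfl; simp at h1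
      refine ⟨Units.mk0 x hx, ?_⟩
      ext
      simp only [powMonoidHom_apply, Units.val_pow_eq_pow_val, Units.val_mk0]
      linear_combination h1

theorem relIndex_sq_positiveIdealSquares (h : IsQuadraticGenerator F d s) :
    (powMonoidHom 2 : Fˣ →* Fˣ).range.relIndex (positiveIdealSquares F) =
      2 ^ (discr F).natAbs.primeFactors.card := by
  have h1 := relIndex_mul_relIndex (powMonoidHom 2 : ℚˣ →* ℚˣ).range
    ((powMonoidHom 2 : Fˣ →* Fˣ).range.comap (Units.map (algebraMap ℚ F : ℚ →* F)))
    ((idealSquares F).comap (Units.map (algebraMap ℚ F : ℚ →* F)))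
    (by rintro _ ⟨a, rfl⟩; exact ⟨Units.map (algebraMap ℚ F : ℚ →* F) a, by simp⟩)
    (comap_mono sq_le_idealSquares)
  rw [h.relIndex_sq_comap_sq, comap_idealSquares h.finrank_eq,
    relIndex_sq_evenOutside _ fun p hp ↦ Nat.prime_of_mem_primeFactors hp, pow_succ'] at h1
  rw [h.positiveIdealSquares_eq, relIndex_sup_right, ← relIndex_comap,
    comap_idealSquares h.finrank_eq]
  exact mul_left_cancel₀ two_ne_zero h1

theorem exists_idealSquares_norm_neg (h : IsQuadraticGenerator F d s) {b : F}
    (hb : Algebra.norm ℚ b = -1) : ∃ a ∈ idealSquares F, Algebra.norm ℚ (a : F) < 0 := by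
  have hb0 : b ≠ 0 := by rintro rfl; simp at hb
  obtain ⟨T, hT⟩ : ∃ T : ℚ, b ^ 2 = T * b + 1 := by
    obtain ⟨x, y, rfl⟩ := h.exists_coord b
    refine ⟨2 * x, ?_⟩
    rw [h.sq_sub_trace_mul, ← h.norm_eq, hb]
    push_cast
    ring
  set m := T.den
  have hm : (m : F) ≠ 0 := Nat.cast_ne_zero.mpr T.den_ne_zero
  have hTm : (T : F) * m = T.num := by
    exact_mod_cast congrArg (Rat.cast (K := F)) (Rat.mul_den_eq_num T)
  obtain ⟨u, v, huv⟩ : IsCoprime T.num (m : ℤ) := Int.isCoprime_iff_gcd_eq_one.mpr T.reduced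
  have huv : (u : F) * T.num + v * m = 1 := by exact_mod_cast congrArg (Int.cast (R := F)) huv
  obtain ⟨w, hw⟩ : ∃ w : 𝓞 F, algebraMap (𝓞 F) F w = m * b := by
    refine ⟨⟨m * b,
      Polynomial.X ^ 2 - Polynomial.C T.num * Polynomial.X - Polynomial.C ((m : ℤ) ^ 2),
      by monicity!, ?_⟩, rfl⟩
    simp only [Polynomial.eval₂_sub, Polynomial.eval₂_mul, Polynomial.eval₂_pow,
      Polynomial.eval₂_X, Polynomial.eval₂_C]
    simp only [eq_intCast, Int.cast_pow, Int.cast_natCast]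
    linear_combination (m : F) ^ 2 * hT + m * b * hTm
  let J : FractionalIdeal (𝓞 F)⁰ F := .spanSingleton _ 1 + .spanSingleton _ b
  have h1J : (1 : F) ∈ J := (FractionalIdeal.mem_add _ _ _).mpr
    ⟨1, FractionalIdeal.mem_spanSingleton_self _ _, 0, FractionalIdeal.zero_mem _, add_zero 1⟩
  have hbJ : b ∈ J := (FractionalIdeal.mem_add _ _ _).mpr
    ⟨0, FractionalIdeal.zero_mem _, b, FractionalIdeal.mem_spanSingleton_self _ _, zero_add b⟩
  have hJ : J ^ 2 = .spanSingleton _ (b / m) := by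
    apply le_antisymm
    · have : J ^ 2 = .spanSingleton _ 1 + .spanSingleton _ b +
          (.spanSingleton _ b + .spanSingleton _ (b ^ 2)) := by
        rw [sq, mul_add, add_mul, add_mul]
        simp only [FractionalIdeal.spanSingleton_mul_spanSingleton, one_mul, mul_one, sq]
      rw [this]
      simp only [← FractionalIdeal.sup_eq_add, sup_le_iff, FractionalIdeal.spanSingleton_le_iff_mem,
        FractionalIdeal.mem_spanSingleton, Algebra.smul_def]
      have hb' : ∃ z : 𝓞 F, algebraMap (𝓞 F) F z * (b / m) = b := ⟨m, by simp; field_simp⟩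
      refine ⟨⟨⟨w - T.num, ?_⟩, hb'⟩, hb', ⟨w, ?_⟩⟩
      · rw [map_sub, map_intCast, hw, ← hTm]
        field_simp
        linear_combination hT
      · rw [hw]
        field_simp
    · rw [FractionalIdeal.spanSingleton_le_iff_mem]
      have e : b / m = (v : 𝓞 F) • (1 * b) + (u : 𝓞 F) • (b * b - 1 * 1) := by
        simp only [Algebra.smul_def, map_intCast]
        field_simp
        linear_combination -b * huv - u * b * hTm - m * u * hT
      rw [e, sq]
      have hmul {x y : F} (hx : x ∈ J) (hy : y ∈ J) :
          x * y ∈ ((J * J : FractionalIdeal (𝓞 F)⁰ F) : Submodule (𝓞 F) F) :=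
        FractionalIdeal.mul_mem_mul hx hy
      exact Submodule.add_mem _ (Submodule.smul_mem _ _ (hmul h1J hbJ))
        (Submodule.smul_mem _ _ (Submodule.sub_mem _ (hmul hbJ hbJ) (hmul h1J h1J)))
  have hJ0 : J ≠ 0 := by
    intro h0
    rw [h0] at h1J
    simp at h1J
  refine ⟨Units.mk0 (b / m) (div_ne_zero hb0 hm), mem_idealSquares.mpr ⟨Units.mk0 J hJ0, hJ⟩, ?_⟩
  rw [Units.val_mk0, div_eq_mul_inv, map_mul, hb, ← Rat.cast_natCast, ← Rat.cast_inv,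
    h.norm_ratCast, neg_one_mul, neg_lt_zero]
  positivity

theorem relIndex_positiveIdealSquares_of_norm (h : IsQuadraticGenerator F d s) {b : F}
    (hb : Algebra.norm ℚ b = -1) : (positiveIdealSquares F).relIndex (idealSquares F) = 2 := by
  obtain ⟨a, ha, han⟩ := h.exists_idealSquares_norm_neg hb
  rw [relIndex_eq_two_iff_exists_notMem_and]
  refine ⟨a, ha, fun h ↦ han.not_gt (mem_positiveIdealSquares.mp h).2, fun c hc ↦ ?_⟩
  rcases (Algebra.norm_ne_zero_iff (R := ℚ).mpr c.ne_zero).lt_or_gt with hcn | hcn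
  · left
    refine mem_positiveIdealSquares.mpr ⟨mul_mem hc ha, ?_⟩
    rw [Units.val_mul, map_mul]
    exact mul_pos_of_neg_of_neg hcn han
  · exact Or.inr (mem_positiveIdealSquares.mpr ⟨hc, hcn⟩)

theorem positiveIdealSquares_eq_of_forall_norm_ne (h : IsQuadraticGenerator F d s)
    (hn : ∀ b : F, Algebra.norm ℚ b ≠ -1) : positiveIdealSquares F = idealSquares F := by
  refine le_antisymm inf_le_left fun a ha ↦ mem_positiveIdealSquares.mpr ⟨ha, ?_⟩
  by_contra! hneg
  obtain ⟨r, hr, har⟩ := exists_abs_norm_eq_sq ha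
  rw [abs_of_nonpos hneg] at har
  apply hn (a * (r⁻¹ : ℚ))
  rw [map_mul, h.norm_ratCast, ← neg_eq_iff_eq_neg.mpr har.symm]
  field_simp

end IsQuadraticGenerator

end

section
variable {F : Type*} [Field F] [NumberField F]

namespace IsQuadraticGenerator

variable {d : ℤ} {s : F}

theorem exists_norm_eq_neg_one_iff (h : IsQuadraticGenerator F d s) :
    (∃ b : F, Algebra.norm ℚ b = -1) ↔
      0 < d ∧ ¬ ∃ p : ℕ, p.Prime ∧ p % 4 = 3 ∧ (p : ℤ) ∣ discr F := by
  have hdvd {p : ℕ} (hp : p.Prime) (hp4 : p % 4 = 3) : (p : ℤ) ∣ discr F ↔ (p : ℤ) ∣ d :=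
    h.dvd_discr_iff hp (by rintro rfl; omega)
  constructor
  · rintro ⟨b, hb⟩
    obtain ⟨x, y, rfl⟩ := h.exists_coord b
    rw [h.norm_eq] at hb
    have hd : 0 < d := by
      by_contra! hd
      have hd : (d : ℚ) ≤ 0 := by exact_mod_cast hd
      nlinarith [sq_nonneg x, mul_nonneg (neg_nonneg.mpr hd) (sq_nonneg y)]
    refine ⟨hd, ?_⟩
    rintro ⟨p, hp, hp4, hpD⟩
    have : Fact p.Prime := ⟨hp⟩
    have hy : y ≠ 0 := by
      rintro rfl
      nlinarith [sq_nonneg x]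
    lift d to ℕ using hd.le
    have hpd : p ∣ d := by exact_mod_cast (hdvd hp hp4).mp hpD
    have hsum : d * (y.num.natAbs * x.den) ^ 2 =
        (x.num.natAbs * y.den) ^ 2 + (x.den * y.den) ^ 2 := by
      zify
      simp only [mul_pow, sq_abs]
      have hx1 := Rat.mul_den_eq_num x
      have hy1 := Rat.mul_den_eq_num y
      have : (d : ℚ) * ((y.num : ℚ) ^ 2 * x.den ^ 2) =
          (x.num : ℚ) ^ 2 * y.den ^ 2 + x.den ^ 2 * y.den ^ 2 := by
        rw [← hx1, ← hy1]
        push_cast at hb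
        linear_combination -(x.den : ℚ) ^ 2 * y.den ^ 2 * hb
      exact_mod_cast this
    have hA : y.num.natAbs * x.den ≠ 0 := by simp [hy]
    have hd0 : d ≠ 0 := by rintro rfl; simp at hd
    have heven := Nat.eq_sq_add_sq_iff.mp ⟨_, _, hsum⟩ p (Nat.mem_primeFactors.mpr
      ⟨hp, hpd.mul_right _, mul_ne_zero hd0 (pow_ne_zero 2 hA)⟩) hp4
    have hv : padicValNat p d = 1 := by
      rw [← Nat.factorization_def d hp]
      exact le_antisymm ((Int.squarefree_natCast.mp h.squarefree).natFactorization_le_one p)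
        (hp.factorization_pos_of_dvd hd0 hpd)
    rw [padicValNat.mul hd0 (pow_ne_zero 2 hA), padicValNat.pow, hv] at heven
    rcases heven with ⟨k, hk⟩
    omega
  · rintro ⟨hd, hn⟩
    lift d to ℕ using hd.le
    obtain ⟨a, b, hab⟩ := Nat.eq_sq_add_sq_iff.mpr fun q hq hq4 ↦ by
      have hqp := Nat.prime_of_mem_primeFactors hq
      exact (hn ⟨q, hqp, hq4, (hdvd hqp hq4).mpr
        (Int.natCast_dvd_natCast.mpr (Nat.dvd_of_mem_primeFactors hq))⟩).elim
    have hb : (b : ℚ) ≠ 0 := by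
      intro hb
      have hb : b = 0 := by exact_mod_cast hb
      exact h.not_sq a (by rw [hab, hb]; push_cast; ring)
    refine ⟨((a / b : ℚ) : F) + ((1 / b : ℚ) : F) * s, ?_⟩
    rw [h.norm_eq, hab]
    push_cast
    field_simp
    ring

theorem nonempty_ringHom_real_iff (h : IsQuadraticGenerator F d s) :
    Nonempty (F →+* ℝ) ↔ 0 < d := by
  constructor
  · rintro ⟨f⟩
    have h1 : f s ^ 2 = d := by rw [← map_pow, h.sq_eq, map_intCast]
    have h2 : (0 : ℝ) ≤ d := h1 ▸ sq_nonneg _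
    exact lt_of_le_of_ne (by exact_mod_cast h2) h.d_ne_zero.symm
  · intro hd
    obtain ⟨f⟩ : Nonempty (F →+* ℂ) := inferInstance
    have hd' : (0 : ℝ) ≤ d := by exact_mod_cast hd.le
    have h1 : f s ^ 2 = (Real.sqrt d : ℂ) ^ 2 := by
      rw [← map_pow, h.sq_eq, map_intCast, ← Complex.ofReal_pow, Real.sq_sqrt hd']
      simp
    have h2 : (starRingEnd ℂ) (f s) = f s := by
      rcases sq_eq_sq_iff_eq_or_eq_neg.mp h1 with h3 | h3 <;> simp [h3]
    have hf : ComplexEmbedding.IsReal f := by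
      rw [ComplexEmbedding.isReal_iff]
      ext z
      obtain ⟨x, y, rfl⟩ := h.exists_coord z
      simp [h2]
    exact ⟨hf.embedding⟩

end IsQuadraticGenerator

theorem rank_eq_one_of_real (hdeg : Module.finrank ℚ F = 2) (hF : Nonempty (F →+* ℝ)) :
    Units.rank F = 1 := by
  obtain ⟨f⟩ := hF
  have h1 := InfinitePlace.card_add_two_mul_card_eq_rank F
  have h2 : 0 < InfinitePlace.nrRealPlaces F := by
    classical
    rw [← InfinitePlace.card_real_embeddings, Fintype.card_pos_iff]
    refine ⟨⟨Complex.ofRealHom.comp f, ?_⟩⟩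
    rw [ComplexEmbedding.isReal_iff]
    ext
    simp
  rw [Units.rank, InfinitePlace.card_eq_nrRealPlaces_add_nrComplexPlaces]
  omega

theorem rank_eq_zero_of_not_real (hdeg : Module.finrank ℚ F = 2) (hF : ¬ Nonempty (F →+* ℝ)) :
    Units.rank F = 0 := by
  have h1 := InfinitePlace.card_add_two_mul_card_eq_rank F
  have h2 : InfinitePlace.nrRealPlaces F = 0 := by
    classical
    rw [← InfinitePlace.card_real_embeddings, Fintype.card_eq_zero_iff]
    exact ⟨fun f ↦ hF ⟨f.2.embedding⟩⟩
  rw [Units.rank, InfinitePlace.card_eq_nrRealPlaces_add_nrComplexPlaces]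
  omega

theorem eq_two_pow_sub_of_mul_eq {c k t : ℕ} (h : c * 2 ^ k = 2 ^ t) : c = 2 ^ (t - k) := by
  have hkt : k ≤ t := (Nat.pow_dvd_pow_iff_le_right (le_refl 2)).mp ⟨c, by rw [← h, mul_comm]⟩
  exact Nat.eq_of_mul_eq_mul_right (pow_pos two_pos k)
    (by rw [h, ← pow_add, Nat.sub_add_cancel hkt])

end

/-- Gauss's genus theory: for a quadratic number field `F` whose discriminant has `t`
distinct prime divisors, the 2-rank of the class group (characterized by the
2-torsion subgroup having cardinality `2 ^ rank`) is `t - 2` if `F` is real and some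
prime `p ≡ 3 (mod 4)` divides the discriminant, and `t - 1` otherwise. -/
theorem genus_theory_two_rank (F : Type) [Field F] [NumberField F]
    (hdeg : Module.finrank ℚ F = 2) :
    ((Nonempty (F →+* ℝ) ∧
        ∃ p : ℕ, p.Prime ∧ p % 4 = 3 ∧ (p : ℤ) ∣ NumberField.discr F) →
      Nat.card {x : ClassGroup (NumberField.RingOfIntegers F) // x ^ 2 = 1}
        = 2 ^ ((NumberField.discr F).natAbs.primeFactors.card - 2)) ∧
    (¬ (Nonempty (F →+* ℝ) ∧
        ∃ p : ℕ, p.Prime ∧ p % 4 = 3 ∧ (p : ℤ) ∣ NumberField.discr F) →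
      Nat.card {x : ClassGroup (NumberField.RingOfIntegers F) // x ^ 2 = 1}
        = 2 ^ ((NumberField.discr F).natAbs.primeFactors.card - 1)) := by
  obtain ⟨d, s, h⟩ := exists_isQuadraticGenerator F hdeg
  have hcard := card_sq_eq_one_mul_eq (F := F)
  have hmul := relIndex_mul_relIndex (powMonoidHom 2 : Fˣ →* Fˣ).range (positiveIdealSquares F)
    (idealSquares F) sq_le_positiveIdealSquares inf_le_left
  rw [h.relIndex_sq_positiveIdealSquares] at hmul
  have hno (hn : ¬ ∃ b : F, Algebra.norm ℚ b = -1) :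
      Nat.card {x : ClassGroup (𝓞 F) // x ^ 2 = 1} * 2 ^ (Units.rank F + 1) =
        2 ^ (discr F).natAbs.primeFactors.card := by
    rw [hcard, ← hmul, h.positiveIdealSquares_eq_of_forall_norm_ne (by simpa using hn),
      relIndex_self, mul_one]
  rw [h.exists_norm_eq_neg_one_iff, ← h.nonempty_ringHom_real_iff] at hno
  constructor
  · rintro ⟨hreal, hp⟩
    have := hno fun h' ↦ h'.2 hp
    rw [rank_eq_one_of_real hdeg hreal] at this
    exact eq_two_pow_sub_of_mul_eq this
  · intro hn
    apply eq_two_pow_sub_of_mul_eq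
    by_cases hreal : Nonempty (F →+* ℝ)
    · obtain ⟨b, hb⟩ := h.exists_norm_eq_neg_one_iff.mpr
        ⟨h.nonempty_ringHom_real_iff.mp hreal, fun hp ↦ hn ⟨hreal, hp⟩⟩
      rw [← hmul, h.relIndex_positiveIdealSquares_of_norm hb, rank_eq_one_of_real hdeg hreal,
        pow_succ, ← mul_assoc] at hcard
      exact Nat.eq_of_mul_eq_mul_right two_pos hcard
    · have := hno fun h' ↦ hreal h'.1
      rwa [rank_eq_zero_of_not_real hdeg hreal] at this
end

section
/- Let F = ℚ(√(-z)) be an imaginary quadratic field, where z is a square-free positive integer. If z has at least s+1 distinct prime divisors, then 2^s divides the class number of F. -/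
open NumberField

section ImaginaryQuadratic

variable {F : Type} [Field F] [NumberField F] {z : ℕ} {α : F}

lemma exists_norm_trace_of_sq_eq_neg (hz : 0 < z) (hdeg : Module.finrank ℚ F = 2)
    (hα : α ^ 2 = -(z : F)) (β : F) :
    ∃ x y : ℚ, Algebra.norm ℚ β = x ^ 2 + z * y ^ 2 ∧ Algebra.trace ℚ F β = 2 * x ∧
      Algebra.trace ℚ F (α * β) = -(2 * z * y) := by
  have hirr : ∀ r : ℚ, algebraMap ℚ F r ≠ α := by
    rintro r rfl
    have h : r ^ 2 = -(z : ℚ) := by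
      apply (algebraMap ℚ F).injective
      simpa using hα
    have : (0 : ℚ) < z := by exact_mod_cast hz
    nlinarith [sq_nonneg r]
  have hli : LinearIndependent ℚ ![(1 : F), α] := by
    rw [LinearIndependent.pair_iff' one_ne_zero]
    intro r h
    exact hirr r (by rw [Algebra.algebraMap_eq_smul_one, h])
  let b := basisOfLinearIndependentOfCardEqFinrank hli (by simp [hdeg])
  have hb0 : b 0 = 1 := by simp [b]
  have hb1 : b 1 = α := by simp [b]
  have hsum : ∀ β : F, β = algebraMap ℚ F (b.repr β 0) + algebraMap ℚ F (b.repr β 1) * α := by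
    intro β
    conv_lhs => rw [← b.sum_repr β]
    simp [Fin.sum_univ_two, hb0, hb1, Algebra.smul_def]
  have hrepr : ∀ x y : ℚ, ∀ i, b.repr (algebraMap ℚ F x + algebraMap ℚ F y * α) i = ![x, y] i := by
    intro x y i
    have : algebraMap ℚ F x + algebraMap ℚ F y * α = x • b 0 + y • b 1 := by
      simp [hb0, hb1, Algebra.smul_def]
    rw [this]
    fin_cases i <;> simp
  have hmat : ∀ x y : ℚ, Algebra.leftMulMatrix b (algebraMap ℚ F x + algebraMap ℚ F y * α) =
      !![x, -(z * y); y, x] := by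
    intro x y
    have h1 : (algebraMap ℚ F x + algebraMap ℚ F y * α) * α =
        algebraMap ℚ F (-(z * y)) + algebraMap ℚ F x * α := by
      simp only [map_neg, map_mul, map_natCast]
      linear_combination algebraMap ℚ F y * hα
    ext i j
    rw [Algebra.leftMulMatrix_eq_repr_mul]
    fin_cases j
    · simp only [Fin.zero_eta, hb0, mul_one, hrepr]
      fin_cases i <;> simp
    · simp only [Fin.mk_one, hb1, h1, hrepr]
      fin_cases i <;> simp
  set x := b.repr β 0
  set y := b.repr β 1
  have hαβ : α * β = algebraMap ℚ F (-(z * y)) + algebraMap ℚ F x * α := by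
    rw [hsum β]
    simp only [map_neg, map_mul, map_natCast]
    linear_combination algebraMap ℚ F y * hα
  refine ⟨x, y, ?_, ?_, ?_⟩
  · rw [Algebra.norm_eq_matrix_det b, hsum β, hmat, Matrix.det_fin_two_of]
    ring
  · rw [Algebra.trace_eq_matrix_trace b, hsum β, hmat, Matrix.trace_fin_two_of]
    ring
  · rw [Algebra.trace_eq_matrix_trace b, hαβ, hmat, Matrix.trace_fin_two_of]
    ring

lemma eq_one_or_eq_one_of_mul_sq_add_mul_sq_eq_four {d e : ℕ} (h0 : 0 < d * e)
    (hsq : Squarefree (d * e)) {a b : ℤ} (h : d * a ^ 2 + e * b ^ 2 = 4) : d = 1 ∨ e = 1 := by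
  have key : ∀ {n : ℕ} {c : ℤ}, Squarefree n → n * c ^ 2 = 4 → n = 1 := by
    intro n c hn hc
    have hdvd : n ∣ 2 := by
      have h4 : n ∣ 2 ^ 2 := by
        have : (n : ℤ) ∣ 4 := ⟨_, hc.symm⟩
        exact_mod_cast this
      exact (hn.dvd_pow_iff_dvd two_ne_zero).1 h4
    rcases (Nat.dvd_prime Nat.prime_two).1 hdvd with rfl | rfl
    · rfl
    · exfalso
      have h2 : c ^ 2 = 2 := by push_cast at hc; omega
      have : c ≤ 1 := by nlinarith
      have : -1 ≤ c := by nlinarith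
      interval_cases c <;> omega
  by_contra! hne
  have hd : 0 < d := Nat.pos_of_mul_pos_right h0
  have he : 0 < e := Nat.pos_of_mul_pos_left h0
  by_cases ha : a = 0
  · exact hne.2 (key (hsq.of_mul_right) (by simpa [ha] using h))
  by_cases hb : b = 0
  · exact hne.1 (key (hsq.of_mul_left) (by simpa [hb] using h))
  have ha2 : 1 ≤ a ^ 2 := by have := sq_pos_of_ne_zero ha; omega
  have hb2 : 1 ≤ b ^ 2 := by have := sq_pos_of_ne_zero hb; omega
  have hde : d ≠ e := by
    rintro rfl
    exact hne.1 (Nat.isUnit_iff.1 (hsq d dvd_rfl))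
  have h5 : (5 : ℤ) ≤ d + e := by omega
  nlinarith

lemma eq_one_or_eq_of_sq_eq_unit_mul (hz : 0 < z) (hsq : Squarefree z)
    (hdeg : Module.finrank ℚ F = 2) (hα : α ^ 2 = -(z : F)) {d : ℕ} (hd : d ∣ z) {γ : F}
    (u : (𝓞 F)ˣ) (hγ : γ ^ 2 = (u : 𝓞 F) * (d : F)) : d = 1 ∨ d = z := by
  obtain ⟨e, rfl⟩ := hd
  have hd0 : 0 < d := Nat.pos_of_mul_pos_right hz
  have he0 : 0 < e := Nat.pos_of_mul_pos_left hz
  have hγint : IsIntegral ℤ γ := by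
    refine IsIntegral.of_pow two_pos ?_
    rw [hγ]
    exact (RingOfIntegers.isIntegral_coe _).mul (isIntegral_natCast _)
  have hαint : IsIntegral ℤ α := by
    refine IsIntegral.of_pow two_pos ?_
    rw [hα]
    exact (isIntegral_natCast _).neg
  have hunit : |Algebra.norm ℚ ((u : 𝓞 F) : F)| = 1 := by
    exact NumberField.isUnit_iff_norm.1 u.isUnit
  obtain ⟨x, y, hN, hT, hT'⟩ := exists_norm_trace_of_sq_eq_neg hz hdeg hα γ
  have hnorm : x ^ 2 + ((d * e : ℕ) : ℚ) * y ^ 2 = d := by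
    have h1 := congrArg (fun t => |Algebra.norm ℚ t|) hγ
    have h2 : Algebra.norm ℚ (d : F) = (d : ℚ) ^ 2 := by
      simpa [hdeg] using Algebra.norm_algebraMap (S := F) (d : ℚ)
    simp only [map_pow, map_mul, abs_mul, hunit, h2, hN, one_mul, abs_pow, Nat.abs_cast] at h1
    rw [sq_abs] at h1
    have h3 := (sq_eq_sq₀ (by positivity) (by positivity)).1 h1
    exact h3
  obtain ⟨a, ha⟩ := IsIntegrallyClosed.isIntegral_iff.1 (Algebra.isIntegral_trace (L := ℚ) hγint)
  obtain ⟨c, hc⟩ := IsIntegrallyClosed.isIntegral_iff.1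
    (Algebra.isIntegral_trace (L := ℚ) (hαint.mul hγint))
  rw [hT, eq_intCast] at ha
  rw [hT', eq_intCast] at hc
  have hsqZ : Squarefree ((d * e : ℕ) : ℤ) := Int.squarefree_natCast.2 hsq
  have hac : ((d * e : ℕ) : ℤ) * a ^ 2 + c ^ 2 = ((d * e : ℕ) : ℤ) * (4 * d) := by
    have : (((d * e : ℕ) : ℤ) * a ^ 2 + c ^ 2 : ℚ) = ((d * e : ℕ) : ℤ) * (4 * d) := by
      rw [ha, hc]
      push_cast at hnorm ⊢
      linear_combination 4 * (d : ℚ) * e * hnorm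
    exact_mod_cast this
  obtain ⟨b, rfl⟩ : ((d * e : ℕ) : ℤ) ∣ c :=
    (hsqZ.dvd_pow_iff_dvd two_ne_zero).1 ⟨4 * d - a ^ 2, by linear_combination hac⟩
  have hab : a ^ 2 + (d * e) * b ^ 2 = 4 * d := by
    apply mul_left_cancel₀ hsqZ.ne_zero
    rw [← hac]
    push_cast
    ring
  have hdsq : Squarefree (d : ℤ) := Int.squarefree_natCast.2 hsq.of_mul_left
  obtain ⟨a, rfl⟩ : (d : ℤ) ∣ a :=
    (hdsq.dvd_pow_iff_dvd two_ne_zero).1 ⟨4 - e * b ^ 2, by linear_combination hab⟩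
  have h4 : (d : ℤ) * a ^ 2 + e * b ^ 2 = 4 := by
    apply mul_left_cancel₀ hdsq.ne_zero
    linear_combination hab
  rcases eq_one_or_eq_one_of_mul_sq_add_mul_sq_eq_four hz hsq h4 with h | h
  · exact Or.inl h
  · exact Or.inr (by rw [h, mul_one])

end ImaginaryQuadratic

lemma Ideal.span_pair_sq_eq_of_sq_eq_neg_mul {R : Type*} [CommRing R] {A : R} {d e : ℕ}
    (hA : A ^ 2 = -((d * e : ℕ) : R)) (hde : d.Coprime e) :
    Ideal.span {(d : R), A} ^ 2 = Ideal.span {(d : R)} := by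
  push_cast at hA
  rw [sq, Ideal.span_pair_mul_span_pair]
  apply le_antisymm
  · rw [Ideal.span_le]
    rintro x (rfl | rfl | rfl | rfl)
    all_goals rw [SetLike.mem_coe, Ideal.mem_span_singleton]
    · exact dvd_mul_right _ _
    · exact dvd_mul_right _ _
    · exact dvd_mul_left _ _
    · exact ⟨-e, by linear_combination hA⟩
  · rw [Ideal.span_singleton_le_iff_mem]
    obtain ⟨r, s, hrs⟩ := Nat.isCoprime_iff_coprime.2 hde
    have hrs' : (r : R) * d + s * e = 1 := by exact_mod_cast congrArg (Int.cast : ℤ → R) hrs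
    have hd : (d : R) = r * (d * d) + -s * (A * A) := by
      linear_combination -(d : R) * hrs' + (s : R) * hA
    have hmem : (r : R) * (d * d) + -s * (A * A) ∈ Ideal.span {(d : R) * d, d * A, A * d, A * A} :=
      Ideal.add_mem _ (Ideal.mul_mem_left _ _ (Ideal.subset_span (by simp)))
        (Ideal.mul_mem_left _ _ (Ideal.subset_span (by simp)))
    rwa [← hd] at hmem

lemma Nat.two_pow_card_primeFactors_le_card_divisors {n : ℕ} (hn : n ≠ 0) :
    2 ^ n.primeFactors.card ≤ n.divisors.card := by
  rw [Nat.card_divisors hn, ← Finset.prod_const]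
  refine Finset.prod_le_prod' fun p hp => ?_
  have := (Nat.prime_of_mem_primeFactors hp).factorization_pos_of_dvd hn
    (Nat.dvd_of_mem_primeFactors hp)
  omega

lemma two_pow_dvd_card_of_injOn {G : Type*} [CommGroup G] [Finite G] {s : ℕ} {D : Finset ℕ}
    (hD : 2 ^ s ≤ D.card) (f : ℕ → G) (hf : Set.InjOn f D) (hf2 : ∀ d ∈ D, f d ^ 2 = 1) :
    2 ^ s ∣ Nat.card G := by
  let H : Subgroup G := (powMonoidHom 2).ker
  have hH : IsPGroup 2 H := fun g => ⟨1, Subtype.ext (MonoidHom.mem_ker.1 g.2)⟩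
  obtain ⟨k, hk⟩ := IsPGroup.iff_card.1 hH
  have hle : D.card ≤ Nat.card H := by
    rw [← Nat.card_eq_finsetCard D]
    exact Nat.card_le_card_of_injective
      (fun d : D => (⟨f d, MonoidHom.mem_ker.2 (hf2 d d.2)⟩ : H))
      fun a b hab => Subtype.ext (hf a.2 b.2 (congrArg Subtype.val hab))
  refine dvd_trans ?_ H.card_subgroup_dvd_card
  rw [hk] at hle ⊢
  exact pow_dvd_pow 2 ((Nat.pow_le_pow_iff_right one_lt_two).1 (hD.trans hle))

/-- If `z` is a square-free positive integer with at least `s + 1` distinct prime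
divisors, then `2 ^ s` divides the class number of the imaginary quadratic field
`ℚ(√(-z))`. -/
theorem two_pow_dvd_classNumber_imag_quad (z s : ℕ) (hz : 0 < z) (hsq : Squarefree z)
    (hfac : s + 1 ≤ z.primeFactors.card)
    (F : Type) [Field F] [NumberField F] (hdeg : Module.finrank ℚ F = 2)
    (hgen : ∃ α : F, α ^ 2 = -(z : F)) :
    2 ^ s ∣ NumberField.classNumber F := by
  obtain ⟨α, hα⟩ := hgen
  have hαint : IsIntegral ℤ α := by
    refine IsIntegral.of_pow two_pos ?_
    rw [hα]
    exact (isIntegral_natCast _).neg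
  obtain ⟨A, rfl⟩ : ∃ A : 𝓞 F, (A : F) = α := ⟨⟨α, hαint⟩, rfl⟩
  have hA : A ^ 2 = -(z : 𝓞 F) := RingOfIntegers.ext (by simpa using hα)
  have hA0 : A ≠ 0 := by
    rintro rfl
    rw [zero_pow two_ne_zero, eq_comm, neg_eq_zero, Nat.cast_eq_zero] at hA
    omega
  obtain ⟨p, hp⟩ : z.primeFactors.Nonempty := Finset.card_pos.1 (by omega)
  have hpp := Nat.prime_of_mem_primeFactors hp
  obtain ⟨n, rfl⟩ := Nat.dvd_of_mem_primeFactors hp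
  have hn0 : n ≠ 0 := (Nat.pos_of_mul_pos_left hz).ne'
  have hpn : p.Coprime n := Nat.coprime_of_squarefree_mul hsq
  have hcard : 2 ^ s ≤ n.divisors.card := by
    refine le_trans ?_ (Nat.two_pow_card_primeFactors_le_card_divisors hn0)
    refine Nat.pow_le_pow_right two_pos ?_
    rw [hpn.primeFactors_mul, hpp.primeFactors] at hfac
    have := Finset.card_union_le {p} n.primeFactors
    rw [Finset.card_singleton] at this
    omega
  let I : ℕ → nonZeroDivisors (Ideal (𝓞 F)) := fun d =>
    ⟨Ideal.span {(d : 𝓞 F), A}, mem_nonZeroDivisors_of_ne_zero fun h => hA0 <| by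
      have : A ∈ Ideal.span {(d : 𝓞 F), A} := Ideal.subset_span (by simp)
      rwa [h] at this⟩
  have hI : ∀ d, d ∣ n → (I d : Ideal (𝓞 F)) ^ 2 = Ideal.span {(d : 𝓞 F)} := by
    rintro d ⟨e, rfl⟩
    refine Ideal.span_pair_sq_eq_of_sq_eq_neg_mul (e := p * e) ?_ ?_
    · rw [hA]
      push_cast
      ring
    · refine Nat.coprime_of_squarefree_mul (hsq.squarefree_of_dvd ⟨1, by ring⟩)
  rw [NumberField.classNumber, ← Nat.card_eq_fintype_card]
  refine two_pow_dvd_card_of_injOn hcard (fun d => ClassGroup.mk0 (I d)) ?_ ?_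
  · intro d hd d' hd' heq
    have hdn : d ∣ n := Nat.dvd_of_mem_divisors hd
    have hdn' : d' ∣ n := Nat.dvd_of_mem_divisors hd'
    obtain ⟨x, y, hx, hy, hxy⟩ := ClassGroup.mk0_eq_mk0_iff.1 heq
    have hspan : Ideal.span {x ^ 2 * (d : 𝓞 F)} = Ideal.span {y ^ 2 * (d' : 𝓞 F)} := by
      have := congrArg (· ^ 2) hxy
      simpa only [mul_pow, hI d hdn, hI d' hdn', Ideal.span_singleton_pow,
        Ideal.span_singleton_mul_span_singleton] using this
    obtain ⟨u, hu⟩ := Ideal.span_singleton_eq_span_singleton.1 hspan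
    have hd0 : 0 < d := Nat.pos_of_dvd_of_pos hdn (by omega)
    obtain ⟨g, a, b, hg, hab, rfl, rfl⟩ := Nat.exists_coprime' (m := d) (n := d')
      (Nat.gcd_pos_of_pos_left _ hd0)
    have habn : a * b ∣ n := hab.mul_dvd_of_dvd_of_dvd
      ((dvd_mul_right _ _).trans hdn) ((dvd_mul_right _ _).trans hdn')
    have hyF : (y : F) ≠ 0 := by simpa using hy
    have huF : (x : F) ^ 2 * a * (u : 𝓞 F) = y ^ 2 * b := by
      have hgF : (g : F) ≠ 0 := by exact_mod_cast hg.ne'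
      apply mul_right_cancel₀ hgF
      have := congrArg (algebraMap (𝓞 F) F) hu
      simp only [map_mul, map_pow, map_natCast, Nat.cast_mul] at this
      linear_combination this
    have hγ : (b * y / x : F) ^ 2 = (u : 𝓞 F) * ((a * b : ℕ) : F) := by
      have hxF : (x : F) ≠ 0 := by simpa using hx
      field_simp
      push_cast
      linear_combination -(b : F) * huF
    rcases eq_one_or_eq_of_sq_eq_unit_mul hz hsq hdeg hα (habn.mul_left p) u hγ with h | h
    · rw [Nat.eq_one_of_mul_eq_one_right h, Nat.eq_one_of_mul_eq_one_left h]
    · have hle := Nat.le_of_dvd (by omega) habn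
      have := hpp.two_le
      nlinarith [Nat.pos_of_ne_zero hn0]
  · intro d hd
    rw [← map_pow, ClassGroup.mk0_eq_one_iff]
    rw [SubmonoidClass.coe_pow, hI d (Nat.dvd_of_mem_divisors hd)]
    exact ⟨⟨d, rfl⟩⟩
end

section
/- Let F = ℚ(√(-z)) be an imaginary quadratic field, where z is a square-free positive integer with exactly s distinct prime divisors and z ≡ 1 (mod 4). Then 2^s divides the class number of F. -/
open NumberField nonZeroDivisors

/-- If `x ^ 2 = a * c` with `a` and `c` coprime, then the ideal `(a)` is the square of `(a, x)`. -/
theorem Ideal.span_pair_sq_of_isCoprime {R : Type*} [CommRing R] {a c x : R}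
    (hac : IsCoprime a c) (hx : x ^ 2 = a * c) :
    Ideal.span {a, x} ^ 2 = Ideal.span {a} := by
  rw [sq, Ideal.span_pair_mul_span_pair]
  apply le_antisymm
  · rw [Ideal.span_le]
    rintro y (rfl | rfl | rfl | rfl) <;> rw [SetLike.mem_coe, Ideal.mem_span_singleton]
    · exact dvd_mul_right _ _
    · exact dvd_mul_right _ _
    · exact dvd_mul_left _ _
    · exact ⟨c, by rw [← sq, hx]⟩
  · rw [Ideal.span_singleton_le_iff_mem]
    obtain ⟨u, v, huv⟩ := hac
    have key : a = u * (a * a) + v * (x * x) := by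
      linear_combination (-a) * huv - v * hx
    rw [key]
    refine Ideal.add_mem _ (Ideal.mul_mem_left _ _ (Ideal.subset_span ?_))
      (Ideal.mul_mem_left _ _ (Ideal.subset_span ?_)) <;> simp [← key]

/-- If `x ^ 2 = -z` with `z` square-free and `z ≡ 1 (mod 4)`, then every divisor of `2 * z`
generates the square of an ideal. -/
theorem Ideal.exists_sq_eq_span_natCast {R : Type*} [CommRing R] {z m : ℕ} {x : R}
    (hx : x ^ 2 = -(z : R)) (hz : Squarefree z) (hmod : z % 4 = 1) (hm : m ∣ 2 * z) :
    ∃ I : Ideal R, I ^ 2 = Ideal.span {(m : R)} := by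
  obtain ⟨e, d, he, ⟨c, rfl⟩, rfl⟩ := (Nat.dvd_mul).1 hm
  have hd : Ideal.span {(d : R), x} ^ 2 = Ideal.span {(d : R)} := by
    refine Ideal.span_pair_sq_of_isCoprime (c := -(c : R)) ?_ (by rw [hx]; push_cast; ring)
    exact ((Nat.coprime_of_squarefree_mul hz).cast (R := R)).neg_right
  have hE : ∃ J : Ideal R, J ^ 2 = Ideal.span {(e : R)} := by
    rcases (Nat.dvd_prime Nat.prime_two).1 he with rfl | rfl
    · exact ⟨⊤, by simp [← Ideal.one_eq_top]⟩
    · obtain ⟨k, hk⟩ : ∃ k, d * c = 4 * k + 1 := ⟨d * c / 4, by omega⟩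
      rw [hk] at hx
      push_cast at hx
      refine ⟨Ideal.span {((2 : ℕ) : R), 1 + x},
        Ideal.span_pair_sq_of_isCoprime (c := x - 2 * k) ⟨-(k * x + 2 * k), -x, ?_⟩ ?_⟩
      · push_cast
        linear_combination -hx
      · push_cast
        linear_combination hx
  obtain ⟨J, hJ⟩ := hE
  exact ⟨J * Ideal.span {(d : R), x}, by
    rw [mul_pow, hJ, hd, Ideal.span_singleton_mul_span_singleton, Nat.cast_mul]⟩

/-- If a finite commutative group has at least `2 ^ s` elements of order dividing `2`, then `2 ^ s`
divides its order. -/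
theorem two_pow_dvd_card_of_sq_eq_one {G ι : Type*} [CommGroup G] [Fintype G] {s : ℕ}
    (t : Finset ι) (ht : t.card = 2 ^ s) (f : ι → G) (hf : Set.InjOn f t)
    (hf2 : ∀ i ∈ t, f i ^ 2 = 1) : 2 ^ s ∣ Fintype.card G := by
  classical
  set H : Subgroup G := (powMonoidHom 2 : G →* G).ker
  have hH : ∀ x : G, x ∈ H ↔ x ^ 2 = 1 := fun x => Iff.rfl
  have : Fact (Nat.Prime 2) := ⟨Nat.prime_two⟩
  have hp : IsPGroup 2 H := fun x => ⟨1, by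
    apply Subtype.ext
    simpa using (hH x).1 x.2⟩
  obtain ⟨r, hr⟩ := IsPGroup.iff_card.1 hp
  have hle : 2 ^ s ≤ 2 ^ r := by
    rw [← ht, ← hr, ← Finset.card_image_of_injOn hf]
    have hsub : ((t.image f : Finset G) : Set G) ⊆ (H : Set G) := by
      intro y hy
      obtain ⟨i, hi, rfl⟩ := Finset.mem_image.1 (Finset.mem_coe.1 hy)
      exact hf2 i hi
    have := Set.ncard_le_ncard hsub (Set.toFinite _)
    rwa [Set.ncard_coe_finset] at this
  have hrs : s ≤ r := (Nat.pow_le_pow_iff_right (by norm_num)).1 hle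
  rw [← Nat.card_eq_fintype_card]
  exact (pow_dvd_pow 2 hrs).trans (hr ▸ H.card_subgroup_dvd_card)

theorem Nat.card_divisors_of_squarefree {n : ℕ} (hn : Squarefree n) :
    n.divisors.card = 2 ^ n.primeFactors.card := by
  rw [Nat.card_divisors hn.ne_zero, ← Finset.prod_const]
  refine Finset.prod_congr rfl fun p hp => ?_
  rw [Nat.factorization_eq_one_of_squarefree hn (Nat.prime_of_mem_primeFactors hp)
    (Nat.dvd_of_mem_primeFactors hp)]

theorem Nat.even_factorization_of_isSquare {n : ℕ} (hn : IsSquare n) (p : ℕ) :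
    Even (n.factorization p) := by
  obtain ⟨k, rfl⟩ := hn
  rw [← sq, Nat.factorization_pow]
  simp

theorem Nat.eq_of_isSquare_mul_of_squarefree {m n : ℕ} (hm : Squarefree m) (hn : Squarefree n)
    (h : IsSquare (m * n)) : m = n := by
  refine Nat.eq_of_factorization_eq hm.ne_zero hn.ne_zero fun p => ?_
  have h1 := Nat.even_factorization_of_isSquare h p
  rw [Nat.factorization_mul hm.ne_zero hn.ne_zero, Finsupp.add_apply] at h1
  have h2 := hm.natFactorization_le_one p
  have h3 := hn.natFactorization_le_one p
  rw [Nat.even_iff] at h1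
  omega

section Quadratic

variable {F : Type*} [Field F] [NumberField F] {z : ℕ} {α : F}

theorem linearIndependent_one_sqrt_neg (hz : 0 < z) (hα : α ^ 2 = -(z : F)) :
    LinearIndependent ℚ ![1, α] := by
  rw [LinearIndependent.pair_iff]
  intro a b hab
  have h1 : (a : F) = -(b * α) := by
    rw [Rat.smul_def, Rat.smul_def, mul_one] at hab
    linear_combination hab
  have h2 : ((a ^ 2 + z * b ^ 2 : ℚ) : F) = 0 := by
    push_cast
    rw [h1]
    linear_combination (b : F) ^ 2 * hα
  have h3 : a ^ 2 + z * b ^ 2 = 0 := by exact_mod_cast h2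
  have hzq : (0 : ℚ) < z := by exact_mod_cast hz
  have hb : b ^ 2 = 0 := by
    have := mul_nonneg hzq.le (sq_nonneg b)
    have : (z : ℚ) * b ^ 2 = 0 := by linarith [sq_nonneg a]
    exact (mul_eq_zero.1 this).resolve_left hzq.ne'
  rw [hb] at h3
  exact ⟨by simpa using h3, by simpa using hb⟩

/-- The basis `1, α` of `ℚ(α)`, where `α ^ 2 = -z`. -/
noncomputable def basisOneSqrtNeg (hdeg : Module.finrank ℚ F = 2) (hz : 0 < z)
    (hα : α ^ 2 = -(z : F)) : Module.Basis (Fin 2) ℚ F :=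
  basisOfLinearIndependentOfCardEqFinrank (linearIndependent_one_sqrt_neg hz hα) (by simp [hdeg])

theorem coe_basisOneSqrtNeg (hdeg : Module.finrank ℚ F = 2) (hz : 0 < z)
    (hα : α ^ 2 = -(z : F)) : ⇑(basisOneSqrtNeg hdeg hz hα) = ![1, α] :=
  coe_basisOfLinearIndependentOfCardEqFinrank _ _

theorem exists_eq_add_mul_sqrt_neg (hdeg : Module.finrank ℚ F = 2) (hz : 0 < z)
    (hα : α ^ 2 = -(z : F)) (x : F) : ∃ a b : ℚ, x = a + b * α := by
  have h := (basisOneSqrtNeg hdeg hz hα).sum_repr x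
  rw [Fin.sum_univ_two, coe_basisOneSqrtNeg, Rat.smul_def, Rat.smul_def] at h
  exact ⟨_, _, by simpa using h.symm⟩

theorem leftMulMatrix_basisOneSqrtNeg (hdeg : Module.finrank ℚ F = 2) (hz : 0 < z)
    (hα : α ^ 2 = -(z : F)) (a b : ℚ) :
    Algebra.leftMulMatrix (basisOneSqrtNeg hdeg hz hα) (a + b * α) = !![a, -z * b; b, a] := by
  set B := basisOneSqrtNeg hdeg hz hα with hB
  have key : ∀ c d : ℚ, ∀ y : F, y = c + d * α → B.repr y 0 = c ∧ B.repr y 1 = d := by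
    intro c d y hy
    have : y = c • B 0 + d • B 1 := by
      rw [hB, coe_basisOneSqrtNeg, Rat.smul_def, Rat.smul_def, hy]
      simp
    rw [this]
    simp
  have h0 := key a b ((a + b * α) * B 0) (by rw [hB, coe_basisOneSqrtNeg]; simp)
  have h1 := key (-z * b) a ((a + b * α) * B 1) (by
    rw [hB, coe_basisOneSqrtNeg]
    push_cast
    linear_combination (b : F) * hα)
  ext i j
  rw [Algebra.leftMulMatrix_eq_repr_mul]
  fin_cases i <;> fin_cases j
  · simpa using h0.1
  · simpa using h1.1
  · simpa using h0.2
  · simpa using h1.2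

/-- The units of an imaginary quadratic field `ℚ(√-z)` are `1` and `-1` if `z` is square-free,
`1 < z` and `z ≠ 3`. -/
theorem units_eq_one_or_neg_one (hdeg : Module.finrank ℚ F = 2) (hz : 1 < z) (hsq : Squarefree z)
    (hz3 : z ≠ 3) (hα : α ^ 2 = -(z : F)) (u : (𝓞 F)ˣ) :
    ((u : 𝓞 F) : F) = 1 ∨ ((u : 𝓞 F) : F) = -1 := by
  have hz0 : 0 < z := by omega
  obtain ⟨a, b, hab⟩ := exists_eq_add_mul_sqrt_neg hdeg hz0 hα ((u : 𝓞 F) : F)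
  have htr : Algebra.trace ℚ F ((u : 𝓞 F) : F) = 2 * a := by
    rw [Algebra.trace_eq_matrix_trace (basisOneSqrtNeg hdeg hz0 hα), hab,
      leftMulMatrix_basisOneSqrtNeg, Matrix.trace_fin_two_of]
    ring
  have hnm : Algebra.norm ℚ ((u : 𝓞 F) : F) = a ^ 2 + z * b ^ 2 := by
    rw [Algebra.norm_eq_matrix_det (basisOneSqrtNeg hdeg hz0 hα), hab,
      leftMulMatrix_basisOneSqrtNeg, Matrix.det_fin_two_of]
    ring
  have hn1 : a ^ 2 + z * b ^ 2 = 1 := by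
    have h := NumberField.isUnit_iff_norm.1 u.isUnit
    rw [RingOfIntegers.coe_norm, hnm, abs_of_nonneg (by positivity)] at h
    exact h
  obtain ⟨t, ht⟩ : ∃ t : ℤ, (t : ℚ) = 2 * a := by
    have h : IsIntegral ℤ (Algebra.trace ℚ F ((u : 𝓞 F) : F)) :=
      Algebra.isIntegral_trace (RingOfIntegers.isIntegral_coe _)
    rw [htr] at h
    obtain ⟨t, ht⟩ := IsIntegrallyClosed.isIntegral_iff.1 h
    exact ⟨t, by simpa using ht⟩
  have ht4 : (t : ℚ) ^ 2 + z * (2 * b) ^ 2 = 4 := by rw [ht]; linear_combination 4 * hn1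
  have hsquare : ∀ m : ℕ, Squarefree m → (m : ℚ) = z * (2 * b) ^ 2 → z = m := by
    intro m hm h
    refine Nat.eq_of_isSquare_mul_of_squarefree hsq hm (Rat.isSquare_natCast_iff.1 ?_)
    exact ⟨z * (2 * b), by push_cast; rw [h]; ring⟩
  have htle : t ^ 2 ≤ 4 := by
    have : (t : ℚ) ^ 2 ≤ 4 := by
      have : (0 : ℚ) ≤ z * (2 * b) ^ 2 := by positivity
      linarith
    exact_mod_cast this
  have hb0 : b = 0 → ((u : 𝓞 F) : F) = 1 ∨ ((u : 𝓞 F) : F) = -1 := by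
    rintro rfl
    have : a = 1 ∨ a = -1 := sq_eq_one_iff.1 (by simpa using hn1)
    rcases this with rfl | rfl <;> simp [hab]
  have h1 : t ≤ 2 := by nlinarith
  have h2 : -2 ≤ t := by nlinarith
  have hzq : (z : ℚ) ≠ 0 := by exact_mod_cast hz0.ne'
  interval_cases t
  · exact hb0 (by simpa [hzq] using (by push_cast at ht4; linarith : (z : ℚ) * (2 * b) ^ 2 = 0))
  · exact absurd (hsquare 3 Nat.prime_three.squarefree (by push_cast at *; linarith)) hz3
  · have h : (1 : ℚ) = z * b ^ 2 := by push_cast at ht4; linarith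
    have := Nat.eq_of_isSquare_mul_of_squarefree hsq squarefree_one
      (Rat.isSquare_natCast_iff.1 ⟨z * b, by push_cast; linear_combination (z : ℚ) * h⟩)
    omega
  · exact absurd (hsquare 3 Nat.prime_three.squarefree (by push_cast at *; linarith)) hz3
  · exact hb0 (by simpa [hzq] using (by push_cast at ht4; linarith : (z : ℚ) * (2 * b) ^ 2 = 0))

/-- If a rational `q` is a square in `ℚ(√-z)`, then `q` or `-z * q` is a square in `ℚ`. -/
theorem isSquare_or_isSquare_neg_mul (hdeg : Module.finrank ℚ F = 2) (hz : 0 < z)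
    (hα : α ^ 2 = -(z : F)) {q : ℚ} {x : F} (hx : x ^ 2 = q) :
    IsSquare q ∨ IsSquare (-z * q) := by
  obtain ⟨a, b, rfl⟩ := exists_eq_add_mul_sqrt_neg hdeg hz hα x
  have h : (a ^ 2 - z * b ^ 2 - q : ℚ) • (1 : F) + (2 * a * b : ℚ) • α = 0 := by
    rw [Rat.smul_def, Rat.smul_def]
    push_cast
    linear_combination hx - (b : F) ^ 2 * hα
  have hind := linearIndependent_one_sqrt_neg hz hα
  rw [LinearIndependent.pair_iff] at hind
  obtain ⟨h1, h2⟩ := hind _ _ h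
  rcases mul_eq_zero.1 h2 with h2 | rfl
  · obtain rfl : a = 0 := by linarith
    exact Or.inr ⟨z * b, by linear_combination (z : ℚ) * h1⟩
  · exact Or.inl ⟨a, by linear_combination -h1⟩

/-- Two ideals with squares `(m)` and `(n)` in the same class force `m * n` or `z * (m * n)` to be
a square. -/
theorem isSquare_mul_of_mk0_eq (hdeg : Module.finrank ℚ F = 2) (hz : 1 < z) (hsq : Squarefree z)
    (hz3 : z ≠ 3) (hα : α ^ 2 = -(z : F)) {m n : ℕ} {I J : (Ideal (𝓞 F))⁰}
    (hI : (I : Ideal (𝓞 F)) ^ 2 = Ideal.span {(m : 𝓞 F)})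
    (hJ : (J : Ideal (𝓞 F)) ^ 2 = Ideal.span {(n : 𝓞 F)})
    (hIJ : ClassGroup.mk0 I = ClassGroup.mk0 J) :
    IsSquare (m * n) ∨ IsSquare (z * (m * n)) := by
  obtain ⟨x, y, hx, hy, hxy⟩ := ClassGroup.mk0_eq_mk0_iff.1 hIJ
  have h : Ideal.span {x ^ 2 * (m : 𝓞 F)} = Ideal.span {y ^ 2 * (n : 𝓞 F)} := by
    simp only [← Ideal.span_singleton_mul_span_singleton, ← Ideal.span_singleton_pow, ← hI, ← hJ,
      ← mul_pow, hxy]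
  obtain ⟨u, hu⟩ := Ideal.span_singleton_eq_span_singleton.1 h
  have huF : ((x : F) ^ 2 * m) * ((u : 𝓞 F) : F) = (y : F) ^ 2 * n := by
    have := congrArg (algebraMap (𝓞 F) F) hu
    simpa using this
  have hxF : (x : F) ≠ 0 := by simpa using hx
  have hsq' : ∀ q : ℚ, (q : F) = ((u : 𝓞 F) : F) * (m * n) → IsSquare q ∨ IsSquare (-z * q) := by
    intro q hq
    refine isSquare_or_isSquare_neg_mul (x := n * y / x) hdeg (by omega) hα ?_
    rw [hq, div_pow, div_eq_iff (pow_ne_zero 2 hxF)]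
    linear_combination (-(n : F)) * huF
  have hneg : ∀ k : ℕ, IsSquare (-(k : ℚ)) → IsSquare k := by
    intro k hk
    have : (k : ℚ) = 0 := le_antisymm (by linarith [hk.nonneg]) (Nat.cast_nonneg k)
    have : k = 0 := by exact_mod_cast this
    simp [this]
  rcases units_eq_one_or_neg_one hdeg hz hsq hz3 hα u with hu1 | hu1
  · rcases hsq' ((m * n : ℕ) : ℚ) (by rw [hu1]; push_cast; ring) with h | h
    · exact Or.inl (Rat.isSquare_natCast_iff.1 h)
    · exact Or.inr (hneg _ (by convert h using 1; push_cast; ring))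
  · rcases hsq' (-((m * n : ℕ) : ℚ)) (by rw [hu1]; push_cast; ring) with h | h
    · exact Or.inl (hneg _ h)
    · exact Or.inr (Rat.isSquare_natCast_iff.1 (by convert h using 1; push_cast; ring))

end Quadratic

/-- If `z` is a square-free positive integer with exactly `s` distinct prime divisors
and `z ≡ 1 (mod 4)`, then `2 ^ s` divides the class number of `ℚ(√(-z))`. -/
theorem two_pow_dvd_classNumber_imag_quad_one_mod_four (z s : ℕ) (hz : 0 < z)
    (hsq : Squarefree z) (hfac : z.primeFactors.card = s) (hmod : z % 4 = 1)
    (F : Type) [Field F] [NumberField F] (hdeg : Module.finrank ℚ F = 2)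
    (hgen : ∃ α : F, α ^ 2 = -(z : F)) :
    2 ^ s ∣ NumberField.classNumber F := by
  obtain ⟨α, hα⟩ := hgen
  rcases Nat.lt_or_ge 1 z with hz1 | hz1
  swap
  · obtain rfl : z = 1 := by omega
    subst hfac
    simp
  have hp : (z.minFac).Prime := Nat.minFac_prime (by omega)
  set p := z.minFac
  obtain ⟨w, hw⟩ : p ∣ z := Nat.minFac_dvd z
  have hpw : p.Coprime w := Nat.coprime_of_squarefree_mul (hw ▸ hsq)
  have hwsq : Squarefree w := hsq.squarefree_of_dvd ⟨p, by rw [hw, mul_comm]⟩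
  have hodd : ¬ 2 ∣ p * w := by omega
  have h2w : Nat.Coprime 2 w :=
    (Nat.Prime.coprime_iff_not_dvd Nat.prime_two).2 fun h => hodd (h.mul_left p)
  have h2p : Nat.Coprime p 2 :=
    ((Nat.Prime.coprime_iff_not_dvd Nat.prime_two).2 fun h => hodd (h.mul_right w)).symm
  have hNsq : Squarefree (2 * w) :=
    (Nat.squarefree_mul h2w).2 ⟨Nat.prime_two.squarefree, hwsq⟩
  have hcard : (2 * w).divisors.card = 2 ^ s := by
    rw [Nat.card_divisors_of_squarefree hNsq, ← hfac, hw, h2w.primeFactors_mul,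
      hpw.primeFactors_mul, Finset.card_union_of_disjoint h2w.disjoint_primeFactors,
      Finset.card_union_of_disjoint hpw.disjoint_primeFactors, Nat.prime_two.primeFactors,
      hp.primeFactors, Finset.card_singleton, Finset.card_singleton]
  have hint : IsIntegral ℤ α := IsIntegral.of_pow two_pos (by
    rw [hα]
    simpa using (isIntegral_algebraMap (R := ℤ) (A := F) (x := (z : ℤ))).neg)
  obtain ⟨β, hβ⟩ : ∃ β : 𝓞 F, algebraMap (𝓞 F) F β = α := ⟨⟨α, hint⟩, rfl⟩
  have hαO : β ^ 2 = -(z : 𝓞 F) := by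
    apply FaithfulSMul.algebraMap_injective (𝓞 F) F
    rw [map_pow, hβ, hα]
    simp
  have hex : ∀ m : ℕ, ∃ I : (Ideal (𝓞 F))⁰,
      m ∈ (2 * w).divisors → (I : Ideal (𝓞 F)) ^ 2 = Ideal.span {(m : 𝓞 F)} := by
    intro m
    by_cases hm : m ∈ (2 * w).divisors
    · have hdvd := Nat.dvd_of_mem_divisors hm
      obtain ⟨I, hI⟩ := Ideal.exists_sq_eq_span_natCast hαO hsq hmod
        (hdvd.trans (mul_dvd_mul_left 2 ⟨p, by rw [hw, mul_comm]⟩))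
      refine ⟨⟨I, mem_nonZeroDivisors_of_ne_zero ?_⟩, fun _ => hI⟩
      rintro rfl
      have hm0 : m ≠ 0 := (Nat.pos_of_mem_divisors hm).ne'
      rw [zero_pow two_ne_zero, eq_comm, Submodule.zero_eq_bot, Ideal.span_singleton_eq_bot] at hI
      exact hm0 (by exact_mod_cast hI)
    · exact ⟨1, fun h => absurd h hm⟩
  choose I hI using hex
  refine two_pow_dvd_card_of_sq_eq_one (2 * w).divisors hcard (fun m => ClassGroup.mk0 (I m))
    ?_ ?_
  · intro m hm n hn hmn
    have hmd := Nat.dvd_of_mem_divisors hm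
    have hnd := Nat.dvd_of_mem_divisors hn
    rcases isSquare_mul_of_mk0_eq hdeg hz1 hsq (by omega) hα (hI m hm) (hI n hn) hmn with h | h
    · exact Nat.eq_of_isSquare_mul_of_squarefree (hNsq.squarefree_of_dvd hmd)
        (hNsq.squarefree_of_dvd hnd) h
    · exfalso
      have hm0 : m ≠ 0 := (Nat.pos_of_mem_divisors hm).ne'
      have hn0 : n ≠ 0 := (Nat.pos_of_mem_divisors hn).ne'
      have hpN : ¬ p ∣ 2 * w :=
        (Nat.Prime.coprime_iff_not_dvd hp).1 (h2p.mul_right hpw)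
      have hev := Nat.even_factorization_of_isSquare h p
      rw [Nat.factorization_mul hz.ne' (mul_ne_zero hm0 hn0), Nat.factorization_mul hm0 hn0,
        Finsupp.add_apply, Finsupp.add_apply, Nat.factorization_eq_one_of_squarefree hsq hp ⟨w, hw⟩,
        Nat.factorization_eq_zero_of_not_dvd fun h => hpN (h.trans hmd),
        Nat.factorization_eq_zero_of_not_dvd fun h => hpN (h.trans hnd)] at hev
      exact absurd hev (by decide)
  · intro m hm
    rw [← map_pow, ClassGroup.mk0_eq_one_iff]
    exact ⟨(m : 𝓞 F), by rw [SubmonoidClass.coe_pow, hI m hm]⟩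
end

section
/- Let K be an imaginary bicyclic biquadratic number field and F its unique real quadratic subfield. Then the class number of F divides the class number of K. -/
open NumberField nonZeroDivisors
open scoped NumberTheorySymbols

theorem exists_sq_sub_mul_sq_eq_mul_sq {d : ℕ} {a r s : ℤ} (hd : ¬ IsSquare d)
    (ha : ¬ IsSquare a.natAbs) (hda : ¬ IsSquare (d * a.natAbs))
    (hco : Nat.Coprime a.natAbs d) (hr : a ∣ r ^ 2 - d) (hs : (d : ℤ) ∣ s ^ 2 - a) :
    ∃ x y z : ℤ, z ≠ 0 ∧ x ^ 2 - d * y ^ 2 = a * z ^ 2 := by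
  set A := a.natAbs with hA
  have hd0 : 0 < d := Nat.pos_of_ne_zero fun h ↦ hd (by simp [h])
  have hA0 : 0 < A := Nat.pos_of_ne_zero fun h ↦ ha (by simp [h])
  have lt_of_le : ∀ {n : ℕ} {x : ℤ}, ¬ IsSquare n → |x| ≤ Nat.sqrt n → x ^ 2 < n := by
    intro n x hn hx
    have h1 : x ^ 2 ≤ (Nat.sqrt n : ℤ) ^ 2 := sq_le_sq' (by linarith [neg_abs_le x])
      (le_trans (le_abs_self x) hx)
    have h2 : Nat.sqrt n ^ 2 < n :=
      lt_of_le_of_ne (Nat.sqrt_le' n) fun h ↦ hn ⟨Nat.sqrt n, by rw [← sq, h]⟩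
    have h3 : ((Nat.sqrt n : ℤ)) ^ 2 < n := by exact_mod_cast h2
    linarith
  have : NeZero d := ⟨hd0.ne'⟩
  have : NeZero A := ⟨hA0.ne'⟩
  let S : Finset (ℕ × ℕ × ℕ) := Finset.range (Nat.sqrt (d * A) + 1) ×ˢ
    Finset.range (Nat.sqrt A + 1) ×ˢ Finset.range (Nat.sqrt d + 1)
  let g : ℕ × ℕ × ℕ → ZMod A × ZMod d := fun t ↦
    ((t.1 : ZMod A) - (r : ZMod A) * t.2.1, (t.1 : ZMod d) - (s : ZMod d) * t.2.2)
  have hcard : (Finset.univ : Finset (ZMod A × ZMod d)).card < S.card := by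
    simp only [Finset.card_univ, Fintype.card_prod, ZMod.card, S, Finset.card_product,
      Finset.card_range]
    have h1 := Nat.lt_succ_sqrt' (d * A)
    have h2 := Nat.lt_succ_sqrt' A
    have h3 := Nat.lt_succ_sqrt' d
    simp only [Nat.succ_eq_add_one] at h1 h2 h3
    refine lt_of_pow_lt_pow_left₀ 2 (Nat.zero_le _) ?_
    calc (A * d) ^ 2 = (d * A) * (A * d) := by ring
      _ < _ := Nat.mul_lt_mul'' h1 (Nat.mul_lt_mul'' h2 h3)
      _ = _ := by ring
  obtain ⟨⟨x₁, y₁, z₁⟩, h₁, ⟨x₂, y₂, z₂⟩, h₂, hne, heq⟩ :=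
    Finset.exists_ne_map_eq_of_card_lt_of_maps_to hcard (f := g) (fun _ _ ↦ Finset.mem_univ _)
  simp only [S, Finset.mem_product, Finset.mem_range] at h₁ h₂
  simp only [g, Prod.mk.injEq] at heq
  set x : ℤ := x₁ - x₂ with hx
  set y : ℤ := y₁ - y₂ with hy
  set z : ℤ := z₁ - z₂ with hz
  have hx2 : x ^ 2 < (d * A : ℕ) := lt_of_le hda (by rw [abs_le]; constructor <;> omega)
  have hy2 : y ^ 2 < (A : ℕ) := lt_of_le ha (by rw [abs_le]; constructor <;> omega)
  have hz2 : z ^ 2 < (d : ℕ) := lt_of_le hd (by rw [abs_le]; constructor <;> omega)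
  have hAx : a ∣ x - r * y := by
    rw [← Int.natAbs_dvd, ← hA, ← ZMod.intCast_zmod_eq_zero_iff_dvd]
    push_cast [hx, hy]
    linear_combination heq.1
  have hdx : (d : ℤ) ∣ x - s * z := by
    rw [← ZMod.intCast_zmod_eq_zero_iff_dvd]
    push_cast [hx, hz]
    linear_combination heq.2
  have h1 : a ∣ x ^ 2 - d * y ^ 2 - a * z ^ 2 := by
    have : x ^ 2 - d * y ^ 2 - a * z ^ 2 =
      (x - r * y) * (x + r * y) + (r ^ 2 - d) * y ^ 2 - a * z ^ 2 := by ring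
    rw [this]
    exact dvd_sub (dvd_add (hAx.mul_right _) (hr.mul_right _)) (dvd_mul_right _ _)
  have h2 : (d : ℤ) ∣ x ^ 2 - d * y ^ 2 - a * z ^ 2 := by
    have : x ^ 2 - d * y ^ 2 - a * z ^ 2 =
      (x - s * z) * (x + s * z) + (s ^ 2 - a) * z ^ 2 - d * y ^ 2 := by ring
    rw [this]
    exact dvd_sub (dvd_add (hdx.mul_right _) (hs.mul_right _)) (dvd_mul_right _ _)
  obtain ⟨k, hk⟩ : a * d ∣ x ^ 2 - d * y ^ 2 - a * z ^ 2 :=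
    IsCoprime.mul_dvd (by rw [Int.isCoprime_iff_nat_coprime]; simpa using hco) h1 h2
  have hd0' : (0 : ℤ) < d := by exact_mod_cast hd0
  have hA0' : (0 : ℤ) < A := by exact_mod_cast hA0
  push_cast at hx2
  have hdy : d * y ^ 2 < d * A := by nlinarith
  have hAz : A * z ^ 2 < d * A := by nlinarith
  have hk01 : k = 0 ∨ k = -1 := by
    have hpos : (0 : ℤ) < d * A := by positivity
    have hx0 := sq_nonneg x
    have hy0 : 0 ≤ d * y ^ 2 := by positivity
    have hz0 : 0 ≤ A * z ^ 2 := by positivity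
    have key : d * A * k < d * A * 1 ∧ d * A * (-2) < d * A * k := by
      rcases Int.natAbs_eq a with h | h <;>
      · rw [← hA] at h
        rw [h] at hk
        constructor <;> linarith
    have e1 := lt_of_mul_lt_mul_left key.1 hpos.le
    have e2 := lt_of_mul_lt_mul_left key.2 hpos.le
    omega
  have hzd : z ^ 2 - d ≠ 0 := by
    have : z ^ 2 < d := hz2
    omega
  rcases hk01 with rfl | rfl
  · refine ⟨x, y, z, ?_, by linarith⟩
    intro hz0
    have e : x ^ 2 = d * y ^ 2 := by rw [hz0] at hk; linarith
    by_cases hy0 : y = 0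
    · have hx0 : x = 0 := by rw [hy0] at e; simpa using e
      apply hne
      simp only [Prod.mk.injEq]
      omega
    · apply hd
      have hdv : y ∣ x := by
        rw [← Int.pow_dvd_pow_iff (n := 2) two_ne_zero, e]
        exact dvd_mul_left _ _
      obtain ⟨c, hc⟩ := hdv
      have : (d : ℤ) = c ^ 2 := by
        have hy2 : y ^ 2 ≠ 0 := pow_ne_zero 2 hy0
        apply mul_right_cancel₀ hy2
        rw [← e, hc]; ring
      refine ⟨c.natAbs, ?_⟩
      zify
      rw [this, abs_mul_abs_self]; ring
  · refine ⟨x * z + d * y, x + y * z, z ^ 2 - d, hzd, ?_⟩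
    linear_combination (z ^ 2 - d) * hk

theorem jacobiSym_eq_of_dvd_add {d p q : ℕ} (hd : d ≠ 0) (hp : Odd p) (hq : Odd q)
    (h : 4 * d ∣ p + q) : J(d | p) = J(d | q) := by
  obtain ⟨e, d', hd', rfl⟩ := Nat.exists_eq_pow_mul_and_not_dvd hd 2 (by simp)
  have hodd : Odd d' := Nat.odd_iff.mpr (Nat.two_dvd_ne_zero.mp hd')
  rw [Nat.cast_mul, jacobiSym.mul_left, jacobiSym.mul_left,
    jacobiSym.quadratic_reciprocity' hodd hp,
    jacobiSym.quadratic_reciprocity' hodd hq, Nat.cast_pow, jacobiSym.pow_left, jacobiSym.pow_left,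
    Nat.cast_two, jacobiSym.at_two hp, jacobiSym.at_two hq]
  have h4 : 4 ∣ p + q := (dvd_mul_right _ _).trans h
  have hd'pq : d' ∣ p + q := ((dvd_mul_left _ _).trans (dvd_mul_left _ _)).trans h
  have hp' : J(p | d') = J(-q | d') := by
    apply jacobiSym.mod_left'
    refine Int.ModEq.symm ?_
    rw [Int.modEq_iff_dvd]
    have : ((d' : ℕ) : ℤ) ∣ ((p + q : ℕ) : ℤ) := Int.natCast_dvd_natCast.mpr hd'pq
    simpa using this
  have hχ : ZMod.χ₄ p = - ZMod.χ₄ q := by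
    have : (p : ZMod 4) = -1 * q := by
      have := (ZMod.natCast_eq_zero_iff _ _).mpr h4
      push_cast at this
      linear_combination this
    rw [this, map_mul, show ZMod.χ₄ (-1) = -1 from rfl, neg_one_mul]
  have hχ2 : ZMod.χ₄ d' * ZMod.χ₄ d' = 1 := by
    rw [← map_mul]
    have : ∀ x : ZMod 4, x * x = 1 → ZMod.χ₄ (x * x) = 1 := by decide
    refine this _ ?_
    obtain ⟨c, rfl⟩ := hodd
    have h : ((4 : ℕ) : ZMod 4) = 0 := ZMod.natCast_self 4
    push_cast at h ⊢
    linear_combination ((c : ZMod 4) ^ 2 + c) * h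
  have hsgn : qrSign p d' * J(p | d') = qrSign q d' * J(q | d') := by
    rw [qrSign, qrSign, hχ, hp', jacobiSym.neg _ hodd, jacobiSym.neg _ hodd]
    linear_combination J(ZMod.χ₄ q | d') * J(q | d') * hχ2
  rw [hsgn]
  congr 1
  rcases e with - | e
  · simp
  · have : (p : ZMod 8) = -1 * q := by
      have h8 : 8 ∣ p + q := by
        refine Dvd.dvd.trans ⟨2 ^ e * d', ?_⟩ h
        ring
      have := (ZMod.natCast_eq_zero_iff _ _).mpr h8
      push_cast at this
      linear_combination this
    rw [this, map_mul]
    simp [show ZMod.χ₈ (-1) = 1 from rfl]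

theorem exists_prime_jacobiSym_eq_one {d m q : ℕ} (hd : d ≠ 0) (hm : m ≠ 0) (hq : q.Prime)
    (hqM : ¬ q ∣ 2 * d * m) (hdq : J(d | q) = 1) :
    ∃ (p : ℕ) (ε : ℤ), p.Prime ∧ p ≠ q ∧ ¬ p ∣ 2 * d * m ∧ |ε| = 1 ∧ J(d | p) = 1 ∧
      J(-m | p) = 1 ∧ (d : ℤ) ∣ q ^ 2 - ε * p * q := by
  have hco : Nat.Coprime q (2 * d * m) := (Nat.Prime.coprime_iff_not_dvd hq).mpr hqM
  have hN : 8 * d * m ≠ 0 := by positivity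
  have hcoN : Nat.Coprime q (8 * d * m) := by
    have h2 : Nat.Coprime q 2 := hco.coprime_dvd_right ⟨d * m, by ring⟩
    have : 8 * d * m = 2 ^ 2 * (2 * d * m) := by ring
    rw [this]
    exact (h2.pow_right 2).mul_right hco
  have hqodd : Odd q := by
    rw [← Nat.coprime_two_right]
    exact hco.coprime_dvd_right ⟨d * m, by ring⟩
  have hmq : J(-m | q) = 1 ∨ J(-m | q) = -1 := by
    apply jacobiSym.eq_one_or_neg_one
    rw [Int.neg_gcd]
    exact (hco.coprime_dvd_right ⟨2 * d, by simp; ring⟩).symm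
  have key : ∀ ε : ℤ, |ε| = 1 → ∃ p : ℕ, p.Prime ∧ p ≠ q ∧ ¬ p ∣ 2 * d * m ∧ Odd p ∧
      ((8 * d * m : ℕ) : ℤ) ∣ p - ε * q := by
    intro ε hε
    have hu : IsCoprime (ε * q) ((8 * d * m : ℕ) : ℤ) := by
      refine IsCoprime.mul_left ?_ (Nat.isCoprime_iff_coprime.mpr hcoN)
      exact ⟨ε, 0, by rw [zero_mul, add_zero, ← sq, ← sq_abs, hε, one_pow]⟩
    obtain ⟨p, hpn, hp, hpe⟩ :=
      Nat.forall_exists_prime_gt_and_zmodEq (max q (8 * d * m)) hN hu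
    have hpn1 : q < p := lt_of_le_of_lt (le_max_left _ _) hpn
    have hpn2 : 8 * d * m < p := lt_of_le_of_lt (le_max_right _ _) hpn
    refine ⟨p, hp, hpn1.ne', fun h ↦ ?_, hp.odd_of_ne_two ?_, hpe.symm.dvd⟩
    · have := Nat.le_of_dvd (by positivity) h
      have e : 8 * d * m = 4 * (2 * d * m) := by ring
      omega
    · have : 0 < d * m := by positivity
      rw [mul_assoc] at hpn2
      omega
  have hdvdq : ∀ {ε : ℤ} {p : ℕ}, |ε| = 1 → ((8 * d * m : ℕ) : ℤ) ∣ p - ε * q →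
      (d : ℤ) ∣ q ^ 2 - ε * p * q := by
    intro ε p hε h
    have h' : (d : ℤ) ∣ p - ε * q := Dvd.dvd.trans ⟨8 * m, by push_cast; ring⟩ h
    have hε2 : ε ^ 2 = 1 := by rw [← sq_abs, hε]; norm_num
    have : (q : ℤ) ^ 2 - ε * p * q = (p - ε * q) * (- ε * q) := by
      linear_combination (- q ^ 2 : ℤ) * hε2
    rw [this]
    exact h'.mul_right _
  rcases hmq with h1 | h1
  · obtain ⟨p, hp, hpq, hpM, hpodd, hpe⟩ := key 1 (by simp)
    have hmod : ∀ {n : ℕ}, (n : ℤ) ∣ p - 1 * q → p % n = q % n := fun h ↦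
      (Nat.modEq_iff_dvd.mpr (by simpa using h)).symm
    refine ⟨p, 1, hp, hpq, hpM, by simp, ?_, ?_, hdvdq (by simp) hpe⟩
    · rw [jacobiSym.mod_right _ hpodd, ← hdq, jacobiSym.mod_right _ hqodd]
      congr 1
      exact hmod (Dvd.dvd.trans ⟨2 * m, by simp; ring⟩ hpe)
    · rw [jacobiSym.mod_right _ hpodd, ← h1, jacobiSym.mod_right _ hqodd]
      congr 1
      exact hmod (Dvd.dvd.trans ⟨2 * d, by simp; ring⟩ hpe)
  · obtain ⟨p, hp, hpq, hpM, hpodd, hpe⟩ := key (-1) (by simp)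
    have hpe' : 8 * d * m ∣ p + q := by
      zify
      convert hpe using 1
      · push_cast; ring
      · ring
    refine ⟨p, -1, hp, hpq, hpM, by simp, ?_, ?_, hdvdq (by simp) hpe⟩
    · rw [← hdq]
      exact jacobiSym_eq_of_dvd_add hd hpodd hqodd (Dvd.dvd.trans ⟨2 * m, by ring⟩ hpe')
    · rw [jacobiSym.neg _ hqodd] at h1
      rw [jacobiSym.neg _ hpodd,
        jacobiSym_eq_of_dvd_add hm hpodd hqodd (Dvd.dvd.trans ⟨2 * d, by ring⟩ hpe')]
      have : (p : ZMod 4) = -1 * q := by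
        have := (ZMod.natCast_eq_zero_iff (p + q) 4).mpr (Dvd.dvd.trans ⟨2 * d * m, by ring⟩ hpe')
        push_cast at this
        linear_combination this
      rw [this, map_mul, show ZMod.χ₄ (-1) = -1 from rfl]
      linarith

section
variable {F : Type*} [Field F] [NumberField F]

theorem exists_mk0_inv_eq_isCoprime {R : Type*} [CommRing R] [IsDedekindDomain R]
    (I : (Ideal R)⁰) {M : Ideal R} (hM : M ≠ ⊥) :
    ∃ J : (Ideal R)⁰, ClassGroup.mk0 I = (ClassGroup.mk0 J)⁻¹ ∧ IsCoprime (J : Ideal R) M := by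
  have hI : (I : Ideal R) ≠ 0 := nonZeroDivisors.coe_ne_zero I
  obtain ⟨a, ha⟩ := IsDedekindDomain.exists_sup_span_eq (I := (I : Ideal R) * M) (J := I)
    Ideal.mul_le_left (mul_ne_zero hI hM)
  obtain ⟨J, hJ⟩ : (I : Ideal R) ∣ Ideal.span {a} := Ideal.dvd_iff_le.mpr (ha ▸ le_sup_right)
  have hcop : IsCoprime J M := by
    rw [Ideal.isCoprime_iff_sup_eq, sup_comm]
    apply mul_left_cancel₀ hI
    rw [Ideal.mul_sup, ← hJ, ha, Ideal.mul_top]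
  by_cases ha0 : a = 0
  · have hM1 : M = ⊤ := by
      rw [ha0, Ideal.span_singleton_zero, sup_bot_eq] at ha
      apply mul_left_cancel₀ hI
      rw [ha, Ideal.mul_top]
    obtain ⟨J, hJ⟩ := ClassGroup.mk0_surjective (ClassGroup.mk0 I)⁻¹
    refine ⟨J, by rw [hJ, inv_inv], ?_⟩
    rw [Ideal.isCoprime_iff_sup_eq, hM1, sup_top_eq]
  · have hJ0 : J ≠ 0 := by
      rintro rfl
      simp [ha0] at hJ
    exact ⟨⟨J, mem_nonZeroDivisors_of_ne_zero hJ0⟩,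
      ClassGroup.mk0_eq_mk0_inv_iff.mpr ⟨a, ha0, hJ.symm⟩, hcop⟩

section relNorm

variable (K F : Type*) [Field K] [NumberField K] [Field F] [NumberField F] [Algebra F K]

/-- The relative norm on nonzero ideals. -/
noncomputable def relNormNonZeroDivisors : (Ideal (𝓞 K))⁰ →* (Ideal (𝓞 F))⁰ where
  toFun I := ⟨Ideal.relNorm (𝓞 F) (I : Ideal (𝓞 K)), mem_nonZeroDivisors_of_ne_zero
    (mt Ideal.relNorm_eq_bot_iff.mp (nonZeroDivisors.coe_ne_zero I))⟩
  map_one' := Subtype.ext (by simp)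
  map_mul' I J := Subtype.ext (by simp)

theorem mk0_relNorm_eq_of_mk0_eq {I J : (Ideal (𝓞 K))⁰} (h : ClassGroup.mk0 I = ClassGroup.mk0 J) :
    ClassGroup.mk0 (relNormNonZeroDivisors K F I) =
      ClassGroup.mk0 (relNormNonZeroDivisors K F J) := by
  obtain ⟨x, y, hx, hy, hxy⟩ := ClassGroup.mk0_eq_mk0_iff.mp h
  refine ClassGroup.mk0_eq_mk0_iff.mpr ⟨Algebra.intNorm (𝓞 F) (𝓞 K) x,
    Algebra.intNorm (𝓞 F) (𝓞 K) y, by simpa using hx, by simpa using hy, ?_⟩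
  have := congrArg (Ideal.relNorm (𝓞 F)) hxy
  simpa [relNormNonZeroDivisors] using this

/-- The norm map on ideal class groups. -/
noncomputable def relNormClassGroup : ClassGroup (𝓞 K) →* ClassGroup (𝓞 F) :=
  MonoidHom.mk' (fun c ↦ ClassGroup.mk0 (relNormNonZeroDivisors K F
    (Function.surjInv ClassGroup.mk0_surjective c))) fun c c' ↦ by
      rw [← map_mul, ← map_mul]
      apply mk0_relNorm_eq_of_mk0_eq
      simp only [map_mul, Function.surjInv_eq]

theorem relNormClassGroup_mk0 (I : (Ideal (𝓞 K))⁰) :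
    relNormClassGroup K F (ClassGroup.mk0 I) = ClassGroup.mk0 (relNormNonZeroDivisors K F I) :=
  mk0_relNorm_eq_of_mk0_eq K F (Function.surjInv_eq _ _)

end relNorm

theorem algebraMap_norm_eq_mul (hF : Module.finrank ℚ F = 2) {σ : F ≃ₐ[ℚ] F} (hσ : σ ≠ 1)
    (x : 𝓞 F) : algebraMap ℤ (𝓞 F) (Algebra.norm ℤ x) =
      x * RingOfIntegers.mapRingEquiv σ.toRingEquiv x := by
  have : Algebra.IsQuadraticExtension ℚ F := ⟨hF⟩
  apply RingOfIntegers.ext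
  have hcard : Nat.card (F ≃ₐ[ℚ] F) = 2 := by rw [IsGalois.card_aut_eq_finrank, hF]
  have h := Algebra.norm_eq_prod_automorphisms ℚ (x : F)
  classical
  have huniv : (Finset.univ : Finset (F ≃ₐ[ℚ] F)) = {1, σ} := by
    symm
    apply Finset.eq_univ_of_card
    rw [Finset.card_pair hσ.symm, ← Nat.card_eq_fintype_card, hcard]
  rw [huniv, Finset.prod_pair hσ.symm, ← Algebra.coe_norm_int] at h
  simpa using h

theorem mul_map_eq_span_absNorm (hF : Module.finrank ℚ F = 2) {σ : F ≃ₐ[ℚ] F} (hσ : σ ≠ 1)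
    (J : Ideal (𝓞 F)) :
    J * J.map (RingOfIntegers.mapRingEquiv σ.toRingEquiv) =
      Ideal.span {(Ideal.absNorm J : 𝓞 F)} := by
  by_cases hJ : J = ⊥
  · simp [hJ]
  set τ := RingOfIntegers.mapRingEquiv σ.toRingEquiv
  have hn : Ideal.absNorm J ≠ 0 := by rwa [Ne, Ideal.absNorm_eq_zero_iff]
  have hle : Ideal.span {(Ideal.absNorm J : 𝓞 F)} ≤ J * J.map τ := by
    have h1 := Ideal.map_relNorm ℤ J (algebraMap ℤ (𝓞 F))
    rw [Ideal.relNorm_int, Ideal.map_span, Set.image_singleton, map_natCast] at h1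
    rw [h1, Ideal.span_le]
    rintro _ ⟨x, hx, rfl⟩
    simp only [Function.comp, Algebra.intNorm_eq_norm]
    rw [algebraMap_norm_eq_mul hF hσ]
    exact Ideal.mul_mem_mul hx (Ideal.mem_map_of_mem _ hx)
  have hτ : Ideal.absNorm (J.map τ) = Ideal.absNorm J :=
    (Nat.card_congr (Ideal.quotientEquiv J (J.map τ) τ rfl).toEquiv).symm
  obtain ⟨C, hC⟩ := Ideal.dvd_iff_le.mpr hle
  have h2 : Ideal.absNorm C = 1 := by
    have := congrArg Ideal.absNorm hC
    rw [Ideal.absNorm_span_natCast, RingOfIntegers.rank, hF, map_mul, map_mul, hτ] at this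
    have h0 : Ideal.absNorm J * Ideal.absNorm J ≠ 0 := mul_ne_zero hn hn
    apply mul_left_cancel₀ h0
    rw [← this]; ring
  rw [Ideal.absNorm_eq_one_iff] at h2
  rw [hC, h2, Ideal.mul_top]

theorem exists_mk0_eq_sq (hF : Module.finrank ℚ F = 2) {σ : F ≃ₐ[ℚ] F} (hσ : σ ≠ 1)
    {b : (Ideal (𝓞 F))⁰} {γ : 𝓞 F} {z : ℤ} (hz : z ≠ 0)
    (h : γ * RingOfIntegers.mapRingEquiv σ.toRingEquiv γ = Ideal.absNorm (b : Ideal (𝓞 F)) * z ^ 2 ∨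
      γ * RingOfIntegers.mapRingEquiv σ.toRingEquiv γ =
        -(Ideal.absNorm (b : Ideal (𝓞 F)) * z ^ 2)) :
    ∃ c : ClassGroup (𝓞 F), ClassGroup.mk0 b = c ^ 2 := by
  set τ := RingOfIntegers.mapRingEquiv σ.toRingEquiv with hτ
  have hb : (b : Ideal (𝓞 F)) ≠ 0 := nonZeroDivisors.coe_ne_zero b
  have hz' : (z : 𝓞 F) ≠ 0 := by exact_mod_cast hz
  set B : Ideal (𝓞 F) := b * Ideal.span {(z : 𝓞 F)} with hB
  have hspan : Ideal.span {γ} * Ideal.span {τ γ} = B * B.map τ := by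
    have e1 : B * B.map τ = Ideal.span {(Ideal.absNorm (b : Ideal (𝓞 F)) : 𝓞 F) * z ^ 2} := by
      rw [hB, Ideal.map_mul, Ideal.map_span, Set.image_singleton, map_intCast, mul_mul_mul_comm,
        mul_map_eq_span_absNorm hF hσ, Ideal.span_singleton_mul_span_singleton,
        Ideal.span_singleton_mul_span_singleton, sq]
    rw [e1, Ideal.span_singleton_mul_span_singleton]
    rcases h with h | h
    · rw [h]
    · rw [h, Ideal.span_singleton_neg]
  have hB0 : B ≠ 0 := mul_ne_zero hb (by simpa using hz')
  have hinj : ∀ I : Ideal (𝓞 F), I ≠ 0 → I.map τ ≠ 0 := by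
    intro I hI h0
    exact hI ((Ideal.map_eq_bot_iff_of_injective τ.injective).mp h0)
  have hγ : γ ≠ 0 := by
    rintro rfl
    have := mul_ne_zero hB0 (hinj B hB0)
    rw [← hspan] at this
    simp at this
  set J := B ⊔ Ideal.span {γ} with hJ
  have hJ0 : J ≠ 0 := fun h0 ↦ hB0 (le_bot_iff.mp (le_sup_left.trans h0.le))
  have hkey : Ideal.span {γ} * J.map τ = B.map τ * J := by
    rw [hJ, Ideal.map_sup, Ideal.map_span, Set.image_singleton, Ideal.mul_sup, Ideal.mul_sup, hspan,
      mul_comm _ (B.map τ), mul_comm B, sup_comm]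
  have hmul : ∀ I : Ideal (𝓞 F), I * I.map τ = Ideal.span {(Ideal.absNorm I : 𝓞 F)} :=
    mul_map_eq_span_absNorm hF hσ
  have hn : ∀ I : Ideal (𝓞 F), I ≠ 0 → (Ideal.absNorm I : 𝓞 F) ≠ 0 := by
    intro I hI
    rw [Nat.cast_ne_zero, Ne, Ideal.absNorm_eq_zero_iff]
    exact hI
  refine ⟨ClassGroup.mk0 ⟨J, mem_nonZeroDivisors_of_ne_zero hJ0⟩, ?_⟩
  rw [← map_pow, ClassGroup.mk0_eq_mk0_iff]
  refine ⟨γ * z * Ideal.absNorm J, Ideal.absNorm B, ?_, ?_, ?_⟩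
  · exact mul_ne_zero (mul_ne_zero hγ hz') (hn J hJ0)
  · exact hn B hB0
  · have : Ideal.span {γ * z * (Ideal.absNorm J : 𝓞 F)} * (b : Ideal (𝓞 F)) =
      B * J * (Ideal.span {γ} * J.map τ) := by
      rw [← Ideal.span_singleton_mul_span_singleton, ← Ideal.span_singleton_mul_span_singleton,
        ← hmul J, hB]
      ring
    rw [this, hkey, ← hmul B]
    simp only [SubmonoidClass.coe_pow]
    ring

end

theorem jacobiSym_eq_one_of_sq_eq {p : ℕ} (hp : p.Prime) {D : ℤ} (hD : ¬ (p : ℤ) ∣ D)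
    {A : Type*} [CommRing A] (hA : Nat.card A = p) {t : A} (ht : t ^ 2 = D) : J(D | p) = 1 := by
  have := Fact.mk hp
  have : Finite A := Nat.finite_of_card_ne_zero (hA ▸ hp.ne_zero)
  have := Fintype.ofFinite A
  let e : ZMod p ≃+* A := ZMod.ringEquivOfPrime A hp (by rw [← hA, Nat.card_eq_fintype_card])
  rw [← jacobiSym.legendreSym.to_jacobiSym, legendreSym.eq_one_iff p]
  · refine ⟨e.symm t, ?_⟩
    rw [← sq, ← map_pow, ht, map_intCast]
  · rwa [Ne, ZMod.intCast_zmod_eq_zero_iff_dvd]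

theorem isPrincipal_or_absNorm_prime {F : Type*} [Field F] [NumberField F]
    (hF : Module.finrank ℚ F = 2) (Q : Ideal (𝓞 F)) [Q.IsMaximal] :
    Q.IsPrincipal ∨ (Ideal.absNorm Q).Prime := by
  obtain ⟨q, n, hn, hmem, hq, hQ⟩ := Ideal.exists_prime_and_absNorm_eq_pow Q
  have hle : Ideal.span {(q : 𝓞 F)} ≤ Q := (Ideal.span_singleton_le_iff_mem Q).mpr hmem
  obtain ⟨C, hC⟩ := Ideal.dvd_iff_le.mpr hle
  have h := congrArg Ideal.absNorm hC
  rw [Ideal.absNorm_span_natCast, RingOfIntegers.rank, hF, map_mul, hQ] at h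
  have hn2 : n ≤ 2 := (Nat.pow_dvd_pow_iff_le_right hq.one_lt).mp (Dvd.intro _ h.symm)
  interval_cases n
  · right
    rwa [hQ, pow_one]
  · left
    have : Ideal.absNorm C = 1 :=
      Nat.eq_of_mul_eq_mul_left (pow_pos hq.pos 2) (by rw [← h, mul_one])
    rw [Ideal.absNorm_eq_one_iff] at this
    rw [this, Ideal.mul_top] at hC
    exact ⟨q, hC.symm⟩

section
variable {K : Type*} [Field K] [NumberField K]

theorem natCast_dvd_of_mem {p : ℕ} (hp : p.Prime) {P : Ideal (𝓞 K)} (hP : P ≠ ⊤)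
    (hpP : (p : 𝓞 K) ∈ P) {n : ℤ} (hn : (n : 𝓞 K) ∈ P) : (p : ℤ) ∣ n := by
  by_contra hc
  obtain ⟨a, b, hab⟩ := ((Nat.prime_iff_prime_int.mp hp).coprime_iff_not_dvd).mpr hc
  apply hP
  rw [Ideal.eq_top_iff_one]
  have : (1 : 𝓞 K) = a * p + b * n := by exact_mod_cast hab.symm
  rw [this]
  exact add_mem (Ideal.mul_mem_left _ _ hpP) (Ideal.mul_mem_left _ _ hn)

theorem apply_eq_of_sq_eq {p : ℕ} (hp : p.Prime) {P : Ideal (𝓞 K)} (hP : P ≠ ⊤)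
    (hpP : (p : 𝓞 K) ∈ P) {D : ℤ} (hD : ¬ (p : ℤ) ∣ 2 * D) (hJ : J(D | p) = 1) {t : 𝓞 K}
    (ht : t ^ 2 = D) (τ : 𝓞 K →+* 𝓞 K) (hτ : ∀ x, τ x - x ^ p ∈ P) : τ t = t := by
  have := Fact.mk hp
  have hodd : p ≠ 2 := by
    rintro rfl
    exact hD (dvd_mul_right _ _)
  have h1 : (p : ℤ) ∣ D ^ (p / 2) - 1 := by
    rw [← ZMod.intCast_zmod_eq_zero_iff_dvd]
    have := legendreSym.eq_pow p D
    rw [jacobiSym.legendreSym.to_jacobiSym, hJ] at this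
    push_cast at this ⊢
    rw [← this, sub_self]
  have h2 : t ^ p - t ∈ P := by
    have : t ^ p - t = t * ((D ^ (p / 2) - 1 : ℤ) : 𝓞 K) := by
      push_cast
      rw [← ht, ← pow_mul, mul_sub, ← pow_succ', Nat.two_mul_div_two_add_one_of_odd
        (hp.odd_of_ne_two hodd), mul_one]
    rw [this]
    obtain ⟨c, hc⟩ := h1
    rw [hc]
    push_cast
    exact Ideal.mul_mem_left _ _ (Ideal.mul_mem_right _ _ hpP)
  have h3 : τ t - t ∈ P := by simpa using add_mem (hτ t) h2
  have h4 : τ t ^ 2 = t ^ 2 := by rw [← map_pow, ht, map_intCast]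
  rcases sq_eq_sq_iff_eq_or_eq_neg.mp h4 with h | h
  · exact h
  · exfalso
    rw [h] at h3
    have h5 : ((2 * (2 * D) : ℤ) : 𝓞 K) ∈ P := by
      have : ((2 * (2 * D) : ℤ) : 𝓞 K) = (-t - t) * (-2 * t) := by
        push_cast
        rw [← ht]
        ring
      rw [this]
      exact Ideal.mul_mem_right _ _ h3
    rcases (Nat.prime_iff_prime_int.mp hp).dvd_or_dvd (natCast_dvd_of_mem hp hP hpP h5) with h | h
    · exact hD (h.mul_right _)
    · exact hD h

theorem exists_absNorm_eq [IsGalois ℚ K] {p : ℕ} (hp : p.Prime) {D E : ℤ}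
    (hD : ¬ (p : ℤ) ∣ 2 * D) (hE : ¬ (p : ℤ) ∣ 2 * E) (hDp : J(D | p) = 1) (hEp : J(E | p) = 1)
    {s t : 𝓞 K} (hs : s ^ 2 = D) (ht : t ^ 2 = E)
    (hgen : ∀ g : Gal(K/ℚ), g (s : K) = s → g (t : K) = t → g = 1) :
    ∃ P : Ideal (𝓞 K), Ideal.absNorm P = p := by
  have hne : Ideal.span {(p : 𝓞 K)} ≠ ⊤ := by
    rw [Ne, ← Ideal.absNorm_eq_one_iff, Ideal.absNorm_span_natCast]
    simp [hp.ne_one, RingOfIntegers.rank, Module.finrank_pos.ne']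
  obtain ⟨P, hPmax, hle⟩ := Ideal.exists_le_maximal _ hne
  have hpP : (p : 𝓞 K) ∈ P := (Ideal.span_singleton_le_iff_mem P).mp hle
  have hP0 : P ≠ ⊥ := by
    rintro rfl
    simp [hp.ne_zero] at hpP
  have : Finite (𝓞 K ⧸ P) := Ideal.finiteQuotientOfFreeOfNeBot P hP0
  obtain ⟨g, hg⟩ := IsArithFrobAt.exists_of_isInvariant (R := ℤ) (G := Gal(K/ℚ)) (Q := P)
  have hcard : Nat.card (ℤ ⧸ P.under ℤ) = p := by
    have : P.under ℤ = Ideal.span {(p : ℤ)} := by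
      apply le_antisymm
      · intro n hn
        rw [Ideal.mem_span_singleton]
        exact natCast_dvd_of_mem hp hPmax.ne_top hpP (by simpa [Ideal.mem_comap] using hn)
      · rw [Ideal.span_singleton_le_iff_mem]
        simpa [Ideal.mem_comap] using hpP
    rw [this]
    simp [Int.card_ideal_quot]
  have hfrob : ∀ x, (g • x) - x ^ p ∈ P := by
    intro x
    have := hg x
    rwa [hcard] at this
  have h1 := apply_eq_of_sq_eq hp hPmax.ne_top hpP hD hDp hs
    (MulSemiringAction.toRingHom _ _ g) hfrob
  have h2 := apply_eq_of_sq_eq hp hPmax.ne_top hpP hE hEp ht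
    (MulSemiringAction.toRingHom _ _ g) hfrob
  have hg1 : g = 1 := hgen g (congrArg (algebraMap (𝓞 K) K) h1) (congrArg (algebraMap (𝓞 K) K) h2)
  refine ⟨P, ?_⟩
  obtain ⟨q, n, hn, hqP, hq, hPn⟩ := Ideal.exists_prime_and_absNorm_eq_pow P
  have hqp : p = q := (Nat.prime_dvd_prime_iff_eq hp hq).mp
    (by exact_mod_cast natCast_dvd_of_mem hp hPmax.ne_top hpP (n := q) (by exact_mod_cast hqP))
  subst hqp
  have hA : ∀ x : 𝓞 K ⧸ P, x ^ p = x := by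
    intro x
    obtain ⟨x, rfl⟩ := Ideal.Quotient.mk_surjective x
    have := hfrob x
    rw [hg1, one_smul] at this
    rw [← map_pow, eq_comm]
    exact Ideal.Quotient.mk_eq_mk_iff_sub_mem _ _ |>.mpr this
  let := Ideal.Quotient.field P
  have := Fintype.ofFinite (𝓞 K ⧸ P)
  have hle' : Ideal.absNorm P ≤ p := by
    have hX : (Polynomial.X ^ p - Polynomial.X : Polynomial (𝓞 K ⧸ P)) ≠ 0 :=
      FiniteField.X_pow_card_sub_X_ne_zero _ hp.one_lt
    have hdeg := Polynomial.card_roots' (Polynomial.X ^ p - Polynomial.X : Polynomial (𝓞 K ⧸ P))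
    rw [FiniteField.X_pow_card_sub_X_natDegree_eq _ hp.one_lt] at hdeg
    classical
    refine le_trans ?_ ((Multiset.toFinset_card_le _).trans hdeg)
    rw [Ideal.absNorm_apply, Submodule.cardQuot_apply]
    rw [Finset.eq_univ_of_forall (s := (Polynomial.roots _).toFinset), Finset.card_univ,
      Nat.card_eq_fintype_card]
    · intro x
      rw [Multiset.mem_toFinset, Polynomial.mem_roots hX]
      simp [hA x]
  rw [hPn] at hle' ⊢
  have hn1 : n ≤ 1 := (Nat.pow_le_pow_iff_right hp.one_lt).mp (by rwa [pow_one])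
  rw [le_antisymm hn1 hn, pow_one]

end

theorem exists_coe_eq_mul_of_sq_eq {L : Type*} [Field L] [NumberField L] {x : L} {r : ℚ}
    (h : x ^ 2 = algebraMap ℚ L r) :
    ∃ n : ℕ, n ≠ 0 ∧ ∃ (y : 𝓞 L) (D : ℤ), (y : L) = n * x ∧ y ^ 2 = D := by
  have hsq : ((r.den : L) * x) ^ 2 = ((r.den * r.num : ℤ) : L) := by
    have h1 : (r.den : ℚ) * r = r.num := by
      rw [mul_comm]; exact Rat.mul_den_eq_num r
    have h2 := congrArg (algebraMap ℚ L) h1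
    simp only [map_mul, map_natCast, map_intCast] at h2
    push_cast
    rw [mul_pow, h, sq, mul_assoc, h2]
  have hint : IsIntegral ℤ ((r.den : L) * x) := by
    apply IsIntegral.of_pow (n := 2) two_pos
    rw [hsq]
    exact isIntegral_algebraMap (R := ℤ) (A := L)
  obtain ⟨y, hy⟩ : ∃ y : 𝓞 L, (y : L) = r.den * x := ⟨⟨_, hint⟩, rfl⟩
  refine ⟨r.den, r.den_ne_zero, y, r.den * r.num, hy, ?_⟩
  apply FaithfulSMul.algebraMap_injective (𝓞 L) L
  rw [map_pow, ← RingOfIntegers.coe_eq_algebraMap y, hy, hsq, map_intCast]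

theorem exists_apply_eq_neg {F : Type*} [Field F] [NumberField F]
    (hF : Module.finrank ℚ F = 2) : ∃ σ : F ≃ₐ[ℚ] F, ∃ (s : 𝓞 F) (D : ℤ),
      s ≠ 0 ∧ s ^ 2 = D ∧ σ s = -s := by
  have : Algebra.IsQuadraticExtension ℚ F := ⟨hF⟩
  have hcard : Nat.card (F ≃ₐ[ℚ] F) = 2 := by rw [IsGalois.card_aut_eq_finrank, hF]
  obtain ⟨σ, hσ, huniv⟩ := (Nat.card_eq_two_iff' (1 : F ≃ₐ[ℚ] F)).mp hcard
  have hσ2 : σ * σ = 1 := by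
    by_contra hc
    exact hσ (mul_eq_left.mp (huniv _ hc))
  obtain ⟨x, hx⟩ : ∃ x, σ x ≠ x := by
    by_contra! hc
    exact hσ (AlgEquiv.ext hc)
  have hσσ : ∀ y, σ (σ y) = y := fun y ↦ DFunLike.congr_fun hσ2 y
  have hneg : σ (x - σ x) = -(x - σ x) := by
    rw [map_sub, hσσ, neg_sub]
  obtain ⟨r, hr⟩ : (x - σ x) ^ 2 ∈ Set.range (algebraMap ℚ F) := by
    rw [IsGalois.mem_range_algebraMap_iff_fixed]
    intro g
    by_cases hg : g = 1
    · rw [hg, AlgEquiv.one_apply]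
    · rw [huniv g hg, map_pow, hneg, neg_sq]
  obtain ⟨n, hn, s, D, hs, hD⟩ := exists_coe_eq_mul_of_sq_eq hr.symm
  refine ⟨σ, s, D, ?_, hD, ?_⟩
  · rintro rfl
    rw [RingOfIntegers.coe_eq_algebraMap, map_zero, eq_comm, mul_eq_zero, sub_eq_zero] at hs
    exact hs.elim (by exact_mod_cast hn) (fun h ↦ hx h.symm)
  · rw [hs, map_mul, map_natCast, hneg, mul_neg]

theorem exists_sq_eq_and_forall_eq_one {K : Type*} [Field K] [NumberField K]
    [IsGalois ℚ K] (hdeg : Module.finrank ℚ K = 4)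
    (hexp : ∀ σ : K ≃ₐ[ℚ] K, σ ^ 2 = 1) {t : K} {D : ℤ} (ht : t ^ 2 = D)
    (htQ : t ∉ Set.range (algebraMap ℚ K)) :
    ∃ (v : 𝓞 K) (E : ℤ), v ^ 2 = E ∧ ∀ g : K ≃ₐ[ℚ] K, g t = t → g v = v → g = 1 := by
  have hcard : Nat.card (K ≃ₐ[ℚ] K) = 4 := by rw [IsGalois.card_aut_eq_finrank, hdeg]
  have hinv : ∀ (g : K ≃ₐ[ℚ] K) x, g (g x) = x := fun g x ↦ by
    have := hexp g
    rw [sq] at this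
    exact DFunLike.congr_fun this x
  have hcomm : ∀ (g h : K ≃ₐ[ℚ] K) x, g (h x) = h (g x) := fun g h x ↦ by
    have : (g * h) ((g * h) (h (g x))) = h (g x) := hinv _ _
    simpa [AlgEquiv.mul_apply, hinv] using this
  have hpm : ∀ g : K ≃ₐ[ℚ] K, g t = t ∨ g t = -t := fun g ↦ by
    apply sq_eq_sq_iff_eq_or_eq_neg.mp
    rw [← map_pow, ht, map_intCast]
  obtain ⟨ρ, hρ⟩ : ∃ ρ : K ≃ₐ[ℚ] K, ρ t ≠ t := by
    by_contra! hc
    exact htQ ((IsGalois.mem_range_algebraMap_iff_fixed t).mpr hc)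
  have hρt : ρ t = -t := (hpm ρ).resolve_left hρ
  have hρ1 : ρ ≠ 1 := by
    rintro rfl
    exact hρ rfl
  classical
  obtain ⟨τ, hτ1, hτt⟩ : ∃ τ : K ≃ₐ[ℚ] K, τ ≠ 1 ∧ τ t = t := by
    obtain ⟨g, -, hg⟩ := Finset.exists_mem_notMem_of_card_lt_card
      (s := ({1, ρ} : Finset (K ≃ₐ[ℚ] K))) (t := Finset.univ) (by
        rw [Finset.card_univ, ← Nat.card_eq_fintype_card, hcard]
        exact lt_of_le_of_lt Finset.card_le_two (by norm_num))
    rw [Finset.mem_insert, Finset.mem_singleton, not_or] at hg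
    rcases hpm g with h | h
    · exact ⟨g, hg.1, h⟩
    · refine ⟨g * ρ, fun hc ↦ hg.2 ?_, by rw [AlgEquiv.mul_apply, hρt, map_neg, h, neg_neg]⟩
      ext x
      have := DFunLike.congr_fun hc (ρ x)
      rwa [AlgEquiv.mul_apply, hinv, AlgEquiv.one_apply] at this
  have hτρ : τ ≠ ρ := by
    rintro rfl
    exact hρ hτt
  have huniv : ∀ g : K ≃ₐ[ℚ] K, g = 1 ∨ g = τ ∨ g = ρ ∨ g = ρ * τ := by
    have : ({1, τ, ρ, ρ * τ} : Finset (K ≃ₐ[ℚ] K)) = Finset.univ := by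
      apply Finset.eq_univ_of_card
      rw [← Nat.card_eq_fintype_card, hcard, Finset.card_insert_of_notMem,
        Finset.card_insert_of_notMem, Finset.card_pair]
      · rwa [Ne, left_eq_mul]
      · rw [Finset.mem_insert, Finset.mem_singleton, not_or, right_eq_mul]
        exact ⟨hτρ, hρ1⟩
      · rw [Finset.mem_insert, Finset.mem_insert, Finset.mem_singleton]
        rintro (h | h | h)
        · exact hτ1 h.symm
        · exact hρ1 h.symm
        · apply hρ
          have := DFunLike.congr_fun h t
          rw [AlgEquiv.mul_apply, hτt] at this
          exact this.symm
    intro g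
    have hg := Finset.mem_univ g
    rw [← this] at hg
    simpa using hg
  obtain ⟨x, hx⟩ : ∃ x, τ x ≠ x := by
    by_contra! hc
    exact hτ1 (AlgEquiv.ext hc)
  set u := x - τ x with hu
  have hu0 : u ≠ 0 := sub_ne_zero.mpr hx.symm
  have hτu : τ u = -u := by rw [hu, map_sub, hinv, neg_sub]
  obtain ⟨w, hw0, hτw, hρw⟩ : ∃ w : K, w ≠ 0 ∧ τ w = -w ∧ (ρ w = w ∨ ρ w = -w) := by
    by_cases h : u + ρ u = 0
    · refine ⟨u, hu0, hτu, Or.inr ?_⟩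
      rw [add_comm] at h
      exact eq_neg_of_add_eq_zero_left h
    · refine ⟨u + ρ u, h, ?_, Or.inl ?_⟩
      · rw [map_add, hcomm τ ρ, hτu, map_neg, neg_add]
      · rw [map_add, hinv, add_comm]
  have hτw2 : τ (w ^ 2) = w ^ 2 := by rw [map_pow, hτw, neg_sq]
  have hρw2 : ρ (w ^ 2) = w ^ 2 := by
    rw [map_pow]
    rcases hρw with h | h <;> simp [h]
  obtain ⟨r, hr⟩ : w ^ 2 ∈ Set.range (algebraMap ℚ K) := by
    rw [IsGalois.mem_range_algebraMap_iff_fixed]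
    intro g
    rcases huniv g with rfl | rfl | rfl | rfl
    · rfl
    · exact hτw2
    · exact hρw2
    · rw [AlgEquiv.mul_apply, hτw2, hρw2]
  obtain ⟨n, hn, v, E, hv, hE⟩ := exists_coe_eq_mul_of_sq_eq hr.symm
  have hv0 : (v : K) ≠ 0 := by
    rw [hv]
    exact mul_ne_zero (by exact_mod_cast hn) hw0
  refine ⟨v, E, hE, fun g hgt hgv ↦ ?_⟩
  rcases huniv g with rfl | rfl | rfl | rfl
  · rfl
  · exfalso
    rw [hv, map_mul, map_natCast, hτw, mul_neg, ← hv] at hgv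
    exact hv0 (self_eq_neg.mp hgv.symm)
  · exact absurd hgt hρ
  · rw [AlgEquiv.mul_apply, hτt] at hgt
    exact absurd hgt hρ

theorem Complex.conj_eq_self_of_sq_eq {z : ℂ} {r : ℤ} (hr : 0 ≤ r) (h : z ^ 2 = r) :
    starRingEnd ℂ z = z := by
  have h1 : z ^ 2 = ((√(r : ℝ) : ℝ) : ℂ) ^ 2 := by
    rw [h, ← Complex.ofReal_pow, Real.sq_sqrt (by exact_mod_cast hr)]
    simp
  rcases sq_eq_sq_iff_eq_or_eq_neg.mp h1 with h | h <;> simp [h]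

theorem lt_zero_of_isEmpty_ringHom_real {K : Type*} [Field K] [NumberField K]
    [IsGalois ℚ K] (himag : IsEmpty (K →+* ℝ)) {t v : K} {D E : ℤ} (ht : t ^ 2 = D)
    (hv : v ^ 2 = E) (hD : 0 ≤ D) (hgen : ∀ g : K ≃ₐ[ℚ] K, g t = t → g v = v → g = 1) :
    E < 0 := by
  by_contra! hE
  obtain ⟨φ⟩ : Nonempty (K →+* ℂ) := inferInstance
  obtain ⟨g, hg⟩ := NumberField.ComplexEmbedding.exists_comp_symm_eq_of_comp_eq (k := ℚ) φ
    (ComplexEmbedding.conjugate φ) (by ext; simp)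
  have hfix : ∀ {x : K} {n : ℤ}, x ^ 2 = n → 0 ≤ n → g.symm x = x := by
    intro x n hx hn
    apply φ.injective
    have h1 := DFunLike.congr_fun hg x
    have h2 : φ x ^ 2 = n := by rw [← map_pow, hx, map_intCast]
    rw [ComplexEmbedding.conjugate_coe_eq, Complex.conj_eq_self_of_sq_eq hn h2] at h1
    exact h1
  have hg1 := hgen g.symm (hfix ht hD) (hfix hv hE)
  rw [hg1] at hg
  have hreal : ComplexEmbedding.IsReal φ := by
    rw [ComplexEmbedding.isReal_iff, ← hg]
    rfl
  exact himag.false hreal.embedding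

theorem exists_sq_sub_mul_sq_eq_prime_mul_prime {d p q : ℕ} {ε : ℤ} (hd : ¬ IsSquare d)
    (hp : p.Prime) (hq : q.Prime) (hpq : p ≠ q) (hpd : ¬ p ∣ d) (hqd : ¬ q ∣ d) (hε : |ε| = 1)
    (hdp : J(d | p) = 1) (hdq : J(d | q) = 1) (h : (d : ℤ) ∣ q ^ 2 - ε * p * q) :
    ∃ x y z : ℤ, z ≠ 0 ∧ x ^ 2 - d * y ^ 2 = ε * p * q * z ^ 2 := by
  have hε' : ε.natAbs = 1 := by
    rw [← Nat.cast_inj (R := ℤ), Int.natCast_natAbs, hε, Nat.cast_one]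
  have hA : (ε * p * q).natAbs = p * q := by simp [Int.natAbs_mul, hε']
  have hcop : Nat.Coprime p q := (Nat.coprime_primes hp hq).mpr hpq
  have hpd' : Nat.Coprime p d := hp.coprime_iff_not_dvd.mpr hpd
  have hqd' : Nat.Coprime q d := hq.coprime_iff_not_dvd.mpr hqd
  have hns : ∀ n : ℕ, Nat.Coprime p n → ¬ IsSquare (n * p) := by
    rintro n hn ⟨k, hk⟩
    have h1 : p ∣ k := hp.dvd_mul.mp ⟨n, by rw [← hk, mul_comm]⟩ |>.elim id id
    have h2 : p * p ∣ n * p := hk ▸ mul_dvd_mul h1 h1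
    have h3 : p ∣ n := Nat.dvd_of_mul_dvd_mul_right hp.pos h2
    exact (hp.coprime_iff_not_dvd.mp hn) h3
  have hsq : ∀ n : ℕ, n.Prime → J(d | n) = 1 → ∃ r : ℤ, (n : ℤ) ∣ r ^ 2 - d := by
    intro n hn hJ
    have := Fact.mk hn
    obtain ⟨r, hr⟩ := ZMod.isSquare_of_jacobiSym_eq_one hJ
    obtain ⟨r, rfl⟩ := ZMod.intCast_surjective r
    refine ⟨r, ?_⟩
    rw [← ZMod.intCast_zmod_eq_zero_iff_dvd]
    push_cast at hr ⊢
    rw [hr, ← sq, sub_self]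
  obtain ⟨r₁, hr₁⟩ := hsq p hp hdp
  obtain ⟨r₂, hr₂⟩ := hsq q hq hdq
  have hcopZ : IsCoprime (p : ℤ) q := Nat.isCoprime_iff_coprime.mpr hcop
  obtain ⟨a, b, hab⟩ := hcopZ
  have hcong : ∀ {n r r' : ℤ}, n ∣ r ^ 2 - d → n ∣ r' - r → n ∣ r' ^ 2 - d := by
    intro n r r' h1 h2
    have : r' ^ 2 - d = (r ^ 2 - d) + (r' - r) * (r' + r) := by ring
    rw [this]
    exact dvd_add h1 (h2.mul_right _)
  have h1 : (p : ℤ) ∣ (a * p * r₂ + b * q * r₁) ^ 2 - d :=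
    hcong hr₁ ⟨a * (r₂ - r₁), by linear_combination r₁ * hab⟩
  have h2 : (q : ℤ) ∣ (a * p * r₂ + b * q * r₁) ^ 2 - d :=
    hcong hr₂ ⟨b * (r₁ - r₂), by linear_combination r₂ * hab⟩
  have h3 : ε * p * q ∣ (a * p * r₂ + b * q * r₁) ^ 2 - d := by
    have : (p * q : ℤ) ∣ (a * p * r₂ + b * q * r₁) ^ 2 - d :=
      IsCoprime.mul_dvd ⟨a, b, hab⟩ h1 h2
    rw [← Int.natAbs_dvd, hA]
    exact_mod_cast this
  refine exists_sq_sub_mul_sq_eq_mul_sq hd ?_ ?_ ?_ h3 h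
  · rw [hA, mul_comm]
    exact hns q hcop
  · rw [hA, mul_comm p, ← mul_assoc]
    exact hns (d * q) (hpd'.mul_right hcop)
  · rw [hA]
    exact hpd'.mul_left hqd'

section
variable {K F : Type*} [Field K] [NumberField K] [Field F] [NumberField F] [Algebra F K]

theorem sq_mem_range_relNormClassGroup (h2 : Module.finrank F K = 2)
    (c : ClassGroup (𝓞 F)) : c ^ 2 ∈ (relNormClassGroup K F).range := by
  obtain ⟨I, rfl⟩ := ClassGroup.mk0_surjective c
  have hI : (I : Ideal (𝓞 F)).map (algebraMap (𝓞 F) (𝓞 K)) ≠ 0 := by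
    intro h0
    exact nonZeroDivisors.coe_ne_zero I ((Ideal.map_eq_bot_iff_of_injective
      (FaithfulSMul.algebraMap_injective _ _)).mp h0)
  refine ⟨ClassGroup.mk0 ⟨_, mem_nonZeroDivisors_of_ne_zero hI⟩, ?_⟩
  rw [relNormClassGroup_mk0, ← map_pow]
  congr 1
  apply Subtype.ext
  have := Ideal.relNorm_algebraMap (𝓞 K) (I : Ideal (𝓞 F))
  rw [← IsFractionRing.finrank_eq (𝓞 F) F (𝓞 K) K, h2] at this
  exact this

theorem mk0_mem_range_relNormClassGroup_of_isMaximal [IsGalois ℚ K]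
    (hF : Module.finrank ℚ F = 2) (h2 : Module.finrank F K = 2) {σ : F ≃ₐ[ℚ] F} {s : 𝓞 F}
    {d m : ℕ} (hd : d ≠ 0) (hm : m ≠ 0) (hs : s ^ 2 = d) (hσ : σ s = -s) {v : 𝓞 K}
    (hv : v ^ 2 = -m)
    (hgen : ∀ g : Gal(K/ℚ), g (algebraMap F K s) = algebraMap F K s → g v = v → g = 1)
    (Q : (Ideal (𝓞 F))⁰) [hmax : (Q : Ideal (𝓞 F)).IsMaximal]
    (hcop : IsCoprime (Q : Ideal (𝓞 F)) (Ideal.span {((2 * d * m : ℕ) : 𝓞 F)})) :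
    ClassGroup.mk0 Q ∈ (relNormClassGroup K F).range := by
  have hs0 : s ≠ 0 := by
    rintro rfl
    rw [zero_pow two_ne_zero, eq_comm, Nat.cast_eq_zero] at hs
    exact hd hs
  have hself : (s : F) ≠ -s := fun h ↦ hs0 (RingOfIntegers.ext (by simpa using self_eq_neg.mp h))
  have hσ1 : σ ≠ 1 := by
    rintro rfl
    exact hself hσ
  have hdsq : ¬ IsSquare d := by
    rintro ⟨k, hk⟩
    have h1 : (s : F) ^ 2 = (k : F) ^ 2 := by
      rw [← map_pow, hs, hk, sq, map_natCast, Nat.cast_mul]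
    rcases sq_eq_sq_iff_eq_or_eq_neg.mp h1 with h | h <;> rw [h] at hσ hself <;>
      simp at hσ <;> exact hself (by simpa using hσ)
  rcases isPrincipal_or_absNorm_prime hF (Q : Ideal (𝓞 F)) with hprin | hq
  · rw [ClassGroup.mk0_eq_one_iff _ |>.mpr hprin]
    exact one_mem _
  set q := Ideal.absNorm (Q : Ideal (𝓞 F)) with hqdef
  have hqM : ¬ q ∣ 2 * d * m := by
    intro h
    have h1 : ((2 * d * m : ℕ) : 𝓞 F) ∈ (Q : Ideal (𝓞 F)) := by
      obtain ⟨c, hc⟩ := h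
      rw [hc, Nat.cast_mul]
      exact Ideal.mul_mem_right _ _ (Ideal.absNorm_mem _)
    rw [Ideal.isCoprime_iff_sup_eq, sup_eq_left.mpr
      ((Ideal.span_singleton_le_iff_mem _).mpr h1)] at hcop
    exact hmax.ne_top hcop
  have hdq : J(d | q) = 1 := by
    refine jacobiSym_eq_one_of_sq_eq hq (D := d) ?_ (A := 𝓞 F ⧸ (Q : Ideal (𝓞 F))) ?_
      (t := Ideal.Quotient.mk _ s) ?_
    · intro h
      exact hqM ((Int.natCast_dvd_natCast.mp h).mul_left 2 |>.mul_right m)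
    · rw [hqdef, Ideal.absNorm_apply, Submodule.cardQuot_apply]
    · rw [← map_pow, hs]
      simp
  obtain ⟨p, ε, hp, hpq, hpM, hε, hdp, hmp, hdvd⟩ :=
    exists_prime_jacobiSym_eq_one hd hm hq hqM hdq
  obtain ⟨x, y, z, hz, hxyz⟩ := exists_sq_sub_mul_sq_eq_prime_mul_prime hdsq hp hq hpq
    (fun h ↦ hpM ((h.mul_left 2).mul_right m)) (fun h ↦ hqM ((h.mul_left 2).mul_right m)) hε hdp
    hdq hdvd
  have hsK : (algebraMap (𝓞 F) (𝓞 K) s) ^ 2 = ((d : ℤ) : 𝓞 K) := by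
    rw [← map_pow, hs]
    simp
  obtain ⟨P, hP⟩ := exists_absNorm_eq (K := K) hp (D := d) (E := -m)
    (fun h ↦ hpM ((by exact_mod_cast h : p ∣ 2 * d).mul_right m))
    (fun h ↦ hpM (by
      rw [mul_neg, dvd_neg] at h
      have h' : p ∣ 2 * m := by exact_mod_cast h
      rw [mul_right_comm]
      exact h'.mul_right d))
    hdp hmp hsK (t := v) (by rw [hv]; simp) hgen
  have hP0 : P ≠ 0 := by
    rintro rfl
    rw [Ideal.zero_eq_bot, Ideal.absNorm_bot] at hP
    exact hp.ne_zero hP.symm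
  let P' : (Ideal (𝓞 K))⁰ := ⟨P, mem_nonZeroDivisors_of_ne_zero hP0⟩
  have hnorm : Ideal.absNorm ((Q * relNormNonZeroDivisors K F P' : (Ideal (𝓞 F))⁰) :
      Ideal (𝓞 F)) = q * p := by
    rw [Submonoid.coe_mul, map_mul, ← hqdef, ← hP]
    congr 1
    exact Ideal.absNorm_relNorm ..
  have hσs : RingOfIntegers.mapRingEquiv σ.toRingEquiv s = -s :=
    RingOfIntegers.ext (by simpa using hσ)
  have hprod : (x + y * s) * RingOfIntegers.mapRingEquiv σ.toRingEquiv (x + y * s) =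
      ((ε * p * q * z ^ 2 : ℤ) : 𝓞 F) := by
    rw [map_add, map_mul, map_intCast, map_intCast, hσs, ← hxyz]
    push_cast
    rw [← hs]
    ring
  obtain ⟨c, hc⟩ := exists_mk0_eq_sq hF hσ1 (b := Q * relNormNonZeroDivisors K F P')
    (γ := x + y * s) hz (by
      rw [hnorm, hprod]
      rcases eq_or_eq_neg_of_abs_eq hε with rfl | rfl
      · left
        push_cast
        ring
      · right
        push_cast
        ring)
  rw [map_mul, ← relNormClassGroup_mk0] at hc
  rw [eq_mul_inv_of_mul_eq hc]
  exact mul_mem (sq_mem_range_relNormClassGroup h2 c) (inv_mem ⟨_, rfl⟩)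

theorem relNormClassGroup_surjective [IsGalois ℚ K]
    (hF : Module.finrank ℚ F = 2) (h2 : Module.finrank F K = 2) {σ : F ≃ₐ[ℚ] F} {s : 𝓞 F}
    {d m : ℕ} (hd : d ≠ 0) (hm : m ≠ 0) (hs : s ^ 2 = d) (hσ : σ s = -s) {v : 𝓞 K}
    (hv : v ^ 2 = -m)
    (hgen : ∀ g : Gal(K/ℚ), g (algebraMap F K s) = algebraMap F K s → g v = v → g = 1) :
    Function.Surjective (relNormClassGroup K F) := by
  rw [← MonoidHom.range_eq_top, eq_top_iff]
  rintro c -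
  obtain ⟨I, rfl⟩ := ClassGroup.mk0_surjective c
  have hM : Ideal.span {((2 * d * m : ℕ) : 𝓞 F)} ≠ ⊥ := by
    rw [Ne, Ideal.span_singleton_eq_bot, Nat.cast_eq_zero]
    positivity
  obtain ⟨J, hJ, hcop⟩ := exists_mk0_inv_eq_isCoprime I hM
  rw [hJ]
  apply inv_mem
  clear hJ
  obtain ⟨J, hJ⟩ := J
  simp only at hcop
  induction J using UniqueFactorizationMonoid.induction_on_prime with
  | h₁ => exact absurd rfl (nonZeroDivisors.ne_zero hJ)
  | h₂ J hu =>
    rw [(ClassGroup.mk0_eq_one_iff hJ).mpr]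
    · exact one_mem _
    · rw [Ideal.isUnit_iff.mp hu]
      infer_instance
  | h₃ J Q hJ0 hQ ih =>
    have hQ' : Q ∈ (Ideal (𝓞 F))⁰ := mem_nonZeroDivisors_of_ne_zero hQ.ne_zero
    have hJ' : J ∈ (Ideal (𝓞 F))⁰ := mem_nonZeroDivisors_of_ne_zero hJ0
    have hmax : Q.IsMaximal := (Ideal.isPrime_of_prime hQ).isMaximal hQ.ne_zero
    have : (⟨Q * J, hJ⟩ : (Ideal (𝓞 F))⁰) = ⟨Q, hQ'⟩ * ⟨J, hJ'⟩ := rfl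
    rw [this, map_mul]
    exact mul_mem (mk0_mem_range_relNormClassGroup_of_isMaximal hF h2 hd hm hs hσ hv hgen ⟨Q, hQ'⟩
      hcop.of_mul_left_left) (ih hJ' hcop.of_mul_left_right)

end

/-- If `K` is an imaginary bicyclic biquadratic number field (a totally imaginary
Galois extension of `ℚ` of degree 4 whose Galois group has exponent 2) and `F` is its
real quadratic subfield, then the class number of `F` divides that of `K`. -/
theorem classNumber_real_quad_subfield_dvd (K : Type) [Field K] [NumberField K]
    [IsGalois ℚ K] (hdeg : Module.finrank ℚ K = 4)
    (hexp : ∀ σ : K ≃ₐ[ℚ] K, σ ^ 2 = 1) (himag : IsEmpty (K →+* ℝ))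
    (F : Type) [Field F] [NumberField F] (hF : Module.finrank ℚ F = 2)
    (hreal : Nonempty (F →+* ℝ)) (f : F →ₐ[ℚ] K) :
    NumberField.classNumber F ∣ NumberField.classNumber K := by
  let := f.toRingHom.toAlgebra
  have : IsScalarTower ℚ F K := IsScalarTower.of_algebraMap_eq fun x ↦ (f.commutes x).symm
  have h2 : Module.finrank F K = 2 := by
    have := Module.finrank_mul_finrank ℚ F K
    rw [hF, hdeg] at this
    lia
  obtain ⟨σ, s, D, hs0, hs, hσ⟩ := exists_apply_eq_neg hF
  have hsF : (s : F) ≠ 0 := RingOfIntegers.coe_ne_zero_iff.mpr hs0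
  have hD : 0 < D := by
    obtain ⟨φ⟩ := hreal
    have h1 : φ s ^ 2 = D := by
      rw [← map_pow, ← map_pow, hs, map_intCast, map_intCast]
    have h3 : 0 < φ s ^ 2 := sq_pos_of_ne_zero ((map_ne_zero φ).mpr hsF)
    rw [h1] at h3
    exact_mod_cast h3
  have htK : algebraMap F K s ^ 2 = D := by
    rw [← map_pow, ← map_pow, hs, map_intCast, map_intCast]
  have htQ : algebraMap F K s ∉ Set.range (algebraMap ℚ K) := by
    rintro ⟨r, hr⟩
    rw [IsScalarTower.algebraMap_apply ℚ F K] at hr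
    have hr' := (algebraMap F K).injective hr
    rw [← hr', AlgEquiv.commutes, hr'] at hσ
    exact hsF (self_eq_neg.mp hσ)
  obtain ⟨v, E, hv, hgen⟩ := exists_sq_eq_and_forall_eq_one hdeg hexp htK htQ
  have hE : E < 0 := lt_zero_of_isEmpty_ringHom_real himag htK (v := (v : K))
    (by rw [← map_pow, hv, map_intCast]) hD.le hgen
  lift D to ℕ using hD.le
  obtain ⟨m, hm⟩ := Int.eq_ofNat_of_zero_le (neg_nonneg.mpr hE.le)
  obtain rfl : E = -m := by lia
  have hsurj := relNormClassGroup_surjective hF h2 (by exact_mod_cast hD.ne')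
    (m := m) (by rintro rfl; simp at hE) (by simpa using hs) hσ (by simpa using hv) hgen
  have := Subgroup.card_dvd_of_surjective _ hsurj
  rwa [Nat.card_eq_fintype_card, Nat.card_eq_fintype_card] at this
end
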